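/- (Quasi-stability of the projection-based interior interpolant for curl-free bubble fields.) Let p ≥ 1 and let u ∈ C¹(K̄, ℂ²) be curl-free (i.e. ∂u₂/∂ξ₁ − ∂u₁/∂ξ₂ = 0 in K) with u·n = 0 on ∂K. Then there exists a unique u_p ∈ RT_p⁰(K) satisfying ⟨div(u − u_p), div v⟩_{0,K} = 0 for all v ∈ RT_p⁰(K) and ⟨u − u_p, curl φ⟩_{0,K} = 0 for all φ ∈ 𝒫_p⁰(K). This u_p is discrete curl-free, i.e. ⟨u_p, curl φ⟩_{0,K} = 0 for all φ ∈ 𝒫_p⁰(K), and there is a constant C > 0 independent of p and u such that ‖u − u_p‖_{0,K} ≤ C p^{1/2} inf_{q ∈ RT_p⁰(K)} ‖u − q‖_{0,K}. -/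

import Mathlib

open MeasureTheory

noncomputable section

/-- The open unit square `K = (0,1)²`. -/
def Ksq : Set (ℝ × ℝ) := Set.Ioo 0 1 ×ˢ Set.Ioo 0 1

/-- `f` is (the function of) a polynomial of degree `≤ p₁` in `ξ₁` and `≤ p₂` in `ξ₂`,
i.e. `f ∈ 𝒫_{p₁,p₂}(K)`. -/
def IsPoly2 (p₁ p₂ : ℕ) (f : ℝ × ℝ → ℂ) : Prop :=
  ∃ c : Fin (p₁ + 1) → Fin (p₂ + 1) → ℂ,
    ∀ x : ℝ × ℝ, f x = ∑ i, ∑ j, c i j * (x.1 : ℂ) ^ (i : ℕ) * (x.2 : ℂ) ^ (j : ℕ)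

/-- `f ∈ 𝒫_p⁰(K)`: polynomial of degree `≤ p` in each variable, vanishing on `∂K`. -/
def MemP0 (p : ℕ) (f : ℝ × ℝ → ℂ) : Prop :=
  IsPoly2 p p f ∧ ∀ t ∈ Set.Icc (0 : ℝ) 1,
    f (t, 0) = 0 ∧ f (t, 1) = 0 ∧ f (0, t) = 0 ∧ f (1, t) = 0

/-- `v ∈ RT_p(K) = 𝒫_{p,p-1}(K) × 𝒫_{p-1,p}(K)`. -/
def MemRT (p : ℕ) (v : ℝ × ℝ → ℂ × ℂ) : Prop :=
  IsPoly2 p (p - 1) (fun x => (v x).1) ∧ IsPoly2 (p - 1) p (fun x => (v x).2)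

/-- `v ∈ RT_p⁰(K)`: Raviart–Thomas field with vanishing normal trace `v·n = 0` on `∂K`. -/
def MemRT0 (p : ℕ) (v : ℝ × ℝ → ℂ × ℂ) : Prop :=
  MemRT p v ∧ ∀ t ∈ Set.Icc (0 : ℝ) 1,
    (v (0, t)).1 = 0 ∧ (v (1, t)).1 = 0 ∧ (v (t, 0)).2 = 0 ∧ (v (t, 1)).2 = 0

/-- partial derivative `∂f/∂ξ₁`. -/
def pd1 (f : ℝ × ℝ → ℂ) (x : ℝ × ℝ) : ℂ := fderiv ℝ f x (1, 0)

/-- partial derivative `∂f/∂ξ₂`. -/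
def pd2 (f : ℝ × ℝ → ℂ) (x : ℝ × ℝ) : ℂ := fderiv ℝ f x (0, 1)

/-- divergence of a 2D vector field. -/
def vdiv (v : ℝ × ℝ → ℂ × ℂ) (x : ℝ × ℝ) : ℂ :=
  pd1 (fun y => (v y).1) x + pd2 (fun y => (v y).2) x

/-- vector curl of a scalar function: `curl φ = (∂φ/∂ξ₂, −∂φ/∂ξ₁)`. -/
def scurl (f : ℝ × ℝ → ℂ) (x : ℝ × ℝ) : ℂ × ℂ := (pd2 f x, -pd1 f x)

/-- gradient of a scalar function. -/
def sgrad (f : ℝ × ℝ → ℂ) (x : ℝ × ℝ) : ℂ × ℂ := (pd1 f x, pd2 f x)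

/-- `L²(K)` inner product of scalar functions. -/
def ip0 (f g : ℝ × ℝ → ℂ) : ℂ := ∫ x in Ksq, f x * starRingEnd ℂ (g x)

/-- `L²(K)` inner product of vector fields. -/
def ip2 (u v : ℝ × ℝ → ℂ × ℂ) : ℂ :=
  ∫ x in Ksq, ((u x).1 * starRingEnd ℂ ((v x).1) + (u x).2 * starRingEnd ℂ ((v x).2))

/-- `L²(K)` norm of a scalar function. -/
def nrm0 (f : ℝ × ℝ → ℂ) : ℝ := Real.sqrt (∫ x in Ksq, ‖f x‖ ^ 2)

/-- `L²(K)` norm of a vector field. -/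
def nrm2 (u : ℝ × ℝ → ℂ × ℂ) : ℝ :=
  Real.sqrt (∫ x in Ksq, (‖(u x).1‖ ^ 2 + ‖(u x).2‖ ^ 2))

section UnitInterval

open Polynomial

/-- Integration of a real polynomial over `(0,1)`, as a linear functional. -/
def unitInt : ℝ[X] →ₗ[ℝ] ℝ where
  toFun q := ∫ x in (0 : ℝ)..1, q.eval x
  map_add' p q := by
    simp only [Polynomial.eval_add]
    exact intervalIntegral.integral_add (p.continuous.intervalIntegrable _ _)
      (q.continuous.intervalIntegrable _ _)
  map_smul' c q := by
    simp [Polynomial.eval_smul]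

theorem unitInt_apply (q : ℝ[X]) : unitInt q = ∫ x in (0 : ℝ)..1, q.eval x := rfl

theorem unitInt_derivative (q : ℝ[X]) : unitInt (derivative q) = q.eval 1 - q.eval 0 :=
  intervalIntegral.integral_eq_sub_of_hasDerivAt (fun x _ => q.hasDerivAt x)
    ((derivative q).continuous.intervalIntegrable _ _)

theorem unitInt_sq_nonneg (q : ℝ[X]) : 0 ≤ unitInt (q * q) :=
  intervalIntegral.integral_nonneg zero_le_one fun x _ => by
    simpa using mul_self_nonneg (q.eval x)

theorem unitInt_C_mul (c : ℝ) (q : ℝ[X]) : unitInt (C c * q) = c * unitInt q := by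
  rw [← smul_eq_C_mul, map_smul, smul_eq_mul]

theorem unitInt_cauchy_schwarz (p q : ℝ[X]) :
    unitInt (p * q) ^ 2 ≤ unitInt (p * p) * unitInt (q * q) := by
  have h : ∀ t : ℝ, 0 ≤ unitInt (p * p) * (t * t) + 2 * unitInt (p * q) * t
      + unitInt (q * q) := by
    intro t
    have := unitInt_sq_nonneg (C t * p + q)
    have e : (C t * p + q) * (C t * p + q)
        = C (t * t) * (p * p) + C (2 * t) * (p * q) + q * q := by
      simp only [C_mul, map_ofNat]; ring
    rw [e, map_add, map_add, unitInt_C_mul, unitInt_C_mul] at this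
    linarith
  have := discrim_le_zero h
  rw [discrim] at this
  linarith

/-- The real shifted Legendre polynomials. -/
def legendre (n : ℕ) : ℝ[X] := (shiftedLegendre n).map (Int.castRingHom ℝ)

theorem natDegree_legendre_le (n : ℕ) : (legendre n).natDegree ≤ n :=
  natDegree_map_le.trans (natDegree_shiftedLegendre n).le

theorem legendre_eval_zero (n : ℕ) : (legendre n).eval 0 = 1 := by
  rw [← coeff_zero_eq_eval_zero, legendre, coeff_map, coeff_shiftedLegendre]
  simp

theorem legendre_eval_one (n : ℕ) : (legendre n).eval 1 = (-1) ^ n := by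
  have h := shiftedLegendre_eval_symm n (1 : ℝ)
  have e : ∀ x : ℝ, aeval x (shiftedLegendre n) = (legendre n).eval x := by
    intro x
    rw [legendre, eval_map, aeval_def]; rfl
  rw [e, e, sub_self, legendre_eval_zero, mul_one] at h
  exact h

theorem unitInt_mul_iterate_derivative (n : ℕ) :
    ∀ k ≤ n, ∀ q : ℝ[X], q.degree < k →
      unitInt (q * derivative^[k] ((X * (1 - X)) ^ n)) = 0 := by
  intro k
  induction k with
  | zero =>
    intro _ q hq
    have : q = 0 := by simpa [Nat.WithBot.lt_zero_iff] using hq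
    simp [this]
  | succ k ih =>
    intro hk q hq
    obtain ⟨g, hg⟩ := pow_sub_dvd_iterate_derivative_pow ((X : ℝ[X]) * (1 - X)) n k
    have hb := unitInt_derivative (q * derivative^[k] ((X * (1 - X)) ^ n))
    have hne : n - k ≠ 0 := by omega
    have hq' : (derivative q).degree < k := by
      by_cases h0 : q = 0
      · simp [h0]
      · have h1 := degree_derivative_lt h0
        rw [degree_eq_natDegree h0] at h1 hq
        have : q.natDegree ≤ k := by
          have : q.natDegree < k + 1 := by exact_mod_cast hq
          omega
        exact h1.trans_le (by exact_mod_cast this)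
    rw [derivative_mul, map_add, ih (by omega) _ hq', zero_add, hg] at hb
    rw [Function.iterate_succ_apply', hg, hb]
    simp [hne]

theorem unitInt_mul_legendre (n : ℕ) (q : ℝ[X]) (hq : q.degree < n) :
    unitInt (q * legendre n) = 0 := by
  have h := congrArg (Polynomial.map (Int.castRingHom ℝ)) (factorial_mul_shiftedLegendre_eq n)
  rw [Polynomial.map_mul, Polynomial.map_natCast, ← iterate_derivative_map] at h
  have h2 := unitInt_mul_iterate_derivative n n le_rfl q hq
  have e : ((X : ℤ[X]) ^ n * (1 - X) ^ n).map (Int.castRingHom ℝ) = (X * (1 - X)) ^ n := by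
    simp [mul_pow]
  rw [e] at h
  rw [← h] at h2
  have e2 : q * ((n.factorial : ℝ[X]) * (shiftedLegendre n).map (Int.castRingHom ℝ))
      = C (n.factorial : ℝ) * (q * legendre n) := by
    rw [legendre, C_eq_natCast]; ring
  rw [e2, unitInt_C_mul] at h2
  exact (mul_eq_zero.1 h2).resolve_left (by exact_mod_cast n.factorial_ne_zero)

theorem unitInt_legendre_sq (n : ℕ) :
    unitInt (legendre n * legendre n) = 1 / (2 * n + 1) := by
  set L := legendre n with hL
  have hb := unitInt_derivative (X * (L * L))
  have hd : (X * derivative L - C (n : ℝ) * L).degree < (n : WithBot ℕ) := by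
    rw [degree_lt_iff_coeff_zero]
    intro m hm
    rcases m with _ | m
    · obtain rfl : n = 0 := by omega
      simp
    · rw [coeff_sub, coeff_X_mul, coeff_C_mul, coeff_derivative]
      rcases hm.eq_or_lt with h | h
      · rw [h]; push_cast; ring
      · rw [coeff_eq_zero_of_natDegree_lt ((natDegree_legendre_le n).trans_lt h)]; simp
  have ho := unitInt_mul_legendre n _ hd
  rw [← hL] at ho
  have e : derivative (X * (L * L))
      = C (2 : ℝ) * ((X * derivative L - C (n : ℝ) * L) * L) + C (2 * n + 1 : ℝ) * (L * L) := by
    simp only [derivative_mul, derivative_X, C_add, C_mul, map_ofNat, map_one]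
    ring
  rw [e, map_add, unitInt_C_mul, unitInt_C_mul, ho] at hb
  simp only [eval_mul, eval_X, hL, legendre_eval_one] at hb
  have h1 : ((-1 : ℝ) ^ n) * (-1) ^ n = 1 := by rw [← mul_pow]; simp
  rw [h1] at hb
  have hpos : (0 : ℝ) < 2 * n + 1 := by positivity
  rw [hL]
  field_simp
  linarith

/-- Sharp inverse trace estimate: the endpoint values of a polynomial of degree `≤ n` are bounded
by `n + 1` times its `L²(0,1)` norm. -/
theorem sq_eval_le_unitInt (e : ℝ) (he : ∀ n, (legendre n).eval e ^ 2 = 1) (n : ℕ) :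
    ∀ r : ℝ[X], r.natDegree ≤ n → r.eval e ^ 2 ≤ (n + 1) ^ 2 * unitInt (r * r) := by
  induction n with
  | zero =>
    intro r hr
    rw [eq_C_of_natDegree_le_zero hr]
    simp [unitInt_apply, pow_two]
  | succ n ih =>
    intro r hr
    set L := legendre (n + 1) with hL
    have hlc : L.coeff (n + 1) ≠ 0 := by
      rw [hL, legendre, coeff_map, coeff_shiftedLegendre]
      simp [Nat.choose_eq_zero_iff]
      omega
    set c := r.coeff (n + 1) / L.coeff (n + 1) with hc
    set s := r - C c * L with hs
    have hsd : s.natDegree ≤ n := by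
      rw [natDegree_le_iff_coeff_eq_zero]
      intro m hm
      rw [hs, coeff_sub, coeff_C_mul]
      rcases (Nat.succ_le_of_lt hm).eq_or_lt with h | h
      · rw [← h, hc]; simp only [Nat.succ_eq_add_one]; field_simp; ring
      · rw [coeff_eq_zero_of_natDegree_lt (hr.trans_lt h),
          coeff_eq_zero_of_natDegree_lt ((natDegree_legendre_le _).trans_lt h)]; simp
    have ho : unitInt (s * L) = 0 := by
      apply unitInt_mul_legendre
      exact (degree_le_of_natDegree_le hsd).trans_lt (by exact_mod_cast Nat.lt_succ_self n)
    have hr' : r = s + C c * L := by rw [hs]; ring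
    have e1 : r * r = s * s + C (2 * c) * (s * L) + C (c * c) * (L * L) := by
      rw [hr']; simp only [C_mul, map_ofNat]; ring
    have e2 : unitInt (r * r) = unitInt (s * s) + c * c * (1 / (2 * ((n : ℝ) + 1) + 1)) := by
      rw [e1, map_add, map_add, unitInt_C_mul, unitInt_C_mul, ho, hL, unitInt_legendre_sq]
      push_cast; ring
    have e3 : r.eval e = s.eval e + c * L.eval e := by
      rw [hr']; simp
    have h4 := ih s hsd
    have h5 := he (n + 1)
    rw [← hL] at h5
    set A := unitInt (s * s)
    set a := s.eval e
    set l := L.eval e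
    have hd : (0 : ℝ) < 2 * ((n : ℝ) + 1) + 1 := by positivity
    set d := 2 * ((n : ℝ) + 1) + 1 with hd'
    have h6 : (a + c * l) ^ 2 * ((n + 1) ^ 2 * d)
        ≤ (a ^ 2 * d + (c * l) ^ 2 * (n + 1) ^ 2) * ((n + 1) ^ 2 + d) := by
      nlinarith [sq_nonneg (a * d - (c * l) * (n + 1) ^ 2)]
    have h7 : (c * l) ^ 2 = c * c := by rw [mul_pow, h5]; ring
    have hN : (0 : ℝ) < (n + 1 : ℝ) ^ 2 := by positivity
    have h8 : (a ^ 2 * d + (c * l) ^ 2 * (n + 1) ^ 2) * ((n + 1) ^ 2 + d)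
        ≤ ((n + 1) ^ 2 * A * d + c * c * (n + 1) ^ 2) * ((n + 1) ^ 2 + d) := by
      rw [h7]; gcongr
    have h9 : ((n + 1) ^ 2 * A * d + c * c * (n + 1) ^ 2) * (((n : ℝ) + 1) ^ 2 + d)
        = ((((n + 1 : ℕ) : ℝ) + 1) ^ 2 * (A + c * c * (1 / d))) * ((n + 1) ^ 2 * d) := by
      field_simp
      rw [hd']
      push_cast
      ring
    rw [e3, e2]
    refine le_of_mul_le_mul_right ((h6.trans h8).trans h9.le) (by positivity)

/-- If `v` is the `L²(0,1)`-projection of `-Q'` onto the polynomials of degree `≤ p` vanishing at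
the endpoints, where `deg Q ≤ p - 1`, then the projection error is controlled by `√p ‖v‖`. -/
theorem unitInt_projection_error (p : ℕ) (hp : 1 ≤ p) (v Q : ℝ[X]) (hv : v.natDegree ≤ p)
    (hQ : Q.natDegree ≤ p - 1)
    (h : ∀ a : ℝ[X], a.natDegree ≤ p → a.eval 0 = 0 → a.eval 1 = 0 →
      unitInt ((v + derivative Q) * a) = 0) :
    unitInt ((v + derivative Q) * (v + derivative Q)) ≤ 8 * p * unitInt (v * v) := by
  have hQ' : (derivative Q).degree < ((p - 1 : ℕ) : WithBot ℕ) := by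
    by_cases h0 : Q = 0
    · simp [h0]
    · have h1 := degree_derivative_lt h0
      rw [degree_eq_natDegree h0] at h1
      exact h1.trans_le (by exact_mod_cast hQ)
  have hQ'' : (derivative Q).degree < (p : WithBot ℕ) :=
    hQ'.trans_le (by exact_mod_cast Nat.sub_le p 1)
  set r := v + derivative Q with hr
  have hrd : r.natDegree ≤ p :=
    natDegree_add_le_of_degree_le hv (natDegree_le_of_degree_le hQ''.le)
  set α := unitInt (r * (1 - X))
  set β := unitInt (r * X)
  have key : ∀ s : ℝ[X], s.natDegree ≤ p →
      unitInt (r * s) = α * s.eval 0 + β * s.eval 1 := by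
    intro s hs
    have h1 := h (s - C (s.eval 0) * (1 - X) - C (s.eval 1) * X)
      (by
        refine (natDegree_sub_le_iff_left ?_).2 ((natDegree_sub_le_iff_left ?_).2 hs)
        · exact (natDegree_C_mul_le _ _).trans ((natDegree_X_le).trans hp)
        · refine (natDegree_C_mul_le _ _).trans (le_trans ?_ hp)
          compute_degree)
      (by simp) (by simp)
    have e : r * (s - C (s.eval 0) * (1 - X) - C (s.eval 1) * X)
        = r * s - C (s.eval 0) * (r * (1 - X)) - C (s.eval 1) * (r * X) := by ring
    rw [e, map_sub, map_sub, unitInt_C_mul, unitInt_C_mul] at h1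
    linarith
  have k1 := key (legendre p) (natDegree_legendre_le p)
  have k2 := key (legendre (p - 1)) ((natDegree_legendre_le _).trans (Nat.sub_le _ _))
  have k3 := key r hrd
  rw [hr, add_mul, map_add, unitInt_mul_legendre _ _ hQ'', legendre_eval_zero, legendre_eval_one]
    at k1
  rw [hr, add_mul, map_add, unitInt_mul_legendre _ _ hQ', legendre_eval_zero, legendre_eval_one]
    at k2
  have c1 := unitInt_cauchy_schwarz v (legendre p)
  have c2 := unitInt_cauchy_schwarz v (legendre (p - 1))
  rw [unitInt_legendre_sq] at c1 c2
  have hps : (-1 : ℝ) ^ p = -(-1) ^ (p - 1) := by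
    obtain ⟨q, rfl⟩ : ∃ q, p = q + 1 := ⟨p - 1, by omega⟩
    simp [pow_succ]
  have hsq : ((-1 : ℝ) ^ (p - 1)) ^ 2 = 1 := by rw [← pow_mul, mul_comm, pow_mul]; simp
  set V := unitInt (v * v) with hV
  have hV0 : 0 ≤ V := unitInt_sq_nonneg v
  set R := unitInt (r * r) with hR
  have hR0 : 0 ≤ R := unitInt_sq_nonneg r
  have hp1 : (1 : ℝ) ≤ p := by exact_mod_cast hp
  have hab : α ^ 2 + β ^ 2 ≤ V / p := by
    have hcast : ((p - 1 : ℕ) : ℝ) = p - 1 := by push_cast [hp]; ring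
    have d1 : V * (1 / (2 * (p : ℝ) + 1)) ≤ V / p := by
      rw [mul_one_div]; gcongr; linarith
    have d2 : V * (1 / (2 * ((p - 1 : ℕ) : ℝ) + 1)) ≤ V / p := by
      rw [mul_one_div, hcast]; gcongr; linarith
    rw [add_zero] at k1 k2
    rw [k1, hps] at c1
    rw [k2] at c2
    nlinarith
  have t0 := sq_eval_le_unitInt 0 (fun n => by rw [legendre_eval_zero]; simp) p r hrd
  have t1 := sq_eval_le_unitInt 1
    (fun n => by rw [legendre_eval_one, ← pow_mul, mul_comm, pow_mul]; simp) p r hrd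
  rw [← hR] at t0 t1
  have m1 : R ^ 2 ≤ (α ^ 2 + β ^ 2) * (r.eval 0 ^ 2 + r.eval 1 ^ 2) := by
    rw [k3]; nlinarith [sq_nonneg (α * r.eval 1 - β * r.eval 0)]
  have m2 : (α ^ 2 + β ^ 2) * (r.eval 0 ^ 2 + r.eval 1 ^ 2)
      ≤ V / p * (2 * (2 * p) ^ 2 * R) := by
    have : ((p : ℝ) + 1) ^ 2 * R ≤ (2 * p) ^ 2 * R := by gcongr; linarith
    gcongr
    linarith
  have m3 : V / p * (2 * (2 * p) ^ 2 * R) = (8 * p * V) * R := by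
    field_simp; ring
  rcases hR0.eq_or_lt with h0 | h0
  · rw [← h0]; positivity
  · have : R * R ≤ (8 * p * V) * R := by rw [← pow_two, ← m3]; exact m1.trans m2
    exact le_of_mul_le_mul_right this h0

end UnitInterval

section ConstrainedProjection

variable {R H G : Type*} [AddCommGroup R] [Module ℂ R] [FiniteDimensional ℂ R]
  [NormedAddCommGroup H] [InnerProductSpace ℂ H] [NormedAddCommGroup G] [InnerProductSpace ℂ G]

theorem exists_inner_sub_eq_zero (T : R →ₗ[ℂ] H) (K : Submodule ℂ R) (u : H) :
    ∃ q ∈ K, ∀ w ∈ K, inner ℂ (T w) (u - T q) = 0 := by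
  obtain ⟨y, hy, z, hz, rfl⟩ := (K.map T).exists_add_mem_mem_orthogonal u
  obtain ⟨q, hq, rfl⟩ := Submodule.mem_map.1 hy
  refine ⟨q, hq, fun w hw => ?_⟩
  rw [add_sub_cancel_left]
  exact (Submodule.mem_orthogonal _ _).1 hz _ (Submodule.mem_map_of_mem hw)

/-- The projection `u_p` with `D u_p` the best approximation of `g` in the range of `D` and
`u - T u_p` orthogonal to the kernel of `D`. -/
theorem existsUnique_constrained_projection (T : R →ₗ[ℂ] H) (hT : Function.Injective T)
    (D : R →ₗ[ℂ] G) (u : H) (g : G) :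
    ∃! r : R, (∀ v, inner ℂ (D v) (g - D r) = 0) ∧
      ∀ w, D w = 0 → inner ℂ (T w) (u - T r) = 0 := by
  obtain ⟨q, -, hq⟩ := exists_inner_sub_eq_zero D ⊤ g
  obtain ⟨n, hn, hn'⟩ := exists_inner_sub_eq_zero T (LinearMap.ker D) (u - T q)
  refine ⟨q + n, ⟨fun v => ?_, fun w hw => ?_⟩, ?_⟩
  · rw [map_add, LinearMap.mem_ker.1 hn, add_zero]
    exact hq v trivial
  · rw [map_add, ← sub_sub]
    exact hn' w hw
  · rintro r ⟨h1, h2⟩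
    have hD : D (r - (q + n)) = 0 := by
      have e : D (r - (q + n)) = (g - D q) - (g - D r) := by
        rw [map_sub, map_add, LinearMap.mem_ker.1 hn]; abel
      rw [← inner_self_eq_zero (𝕜 := ℂ)]
      nth_rewrite 2 [e]
      rw [inner_sub_right, hq _ trivial, h1, sub_zero]
    have hT0 : T (r - (q + n)) = 0 := by
      have e : T (r - (q + n)) = (u - T q - T n) - (u - T r) := by
        rw [map_sub, map_add]; abel
      rw [← inner_self_eq_zero (𝕜 := ℂ)]
      nth_rewrite 2 [e]
      rw [inner_sub_right, hn' _ hD, h2 _ hD, sub_zero]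
    exact sub_eq_zero.1 (hT (hT0.trans (map_zero T).symm))

/-- An element orthogonal to the kernel of `D` is a discrete gradient, i.e. it is represented
through `D`. -/
theorem exists_inner_eq_inner_of_orthogonal_ker (T : R →ₗ[ℂ] H) (D : R →ₗ[ℂ] G) (e : R)
    (he : ∀ w, D w = 0 → inner ℂ (T e) (T w) = 0) :
    ∃ m : R, ∀ w, inner ℂ (T e) (T w) = inner ℂ (D m) (D w) := by
  let f : Module.Dual ℂ R := (innerSL ℂ (T e)).toLinearMap ∘ₗ T
  have hf : f ∈ (LinearMap.range D.dualMap) := by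
    rw [LinearMap.range_dualMap_eq_dualAnnihilator_ker, Submodule.mem_dualAnnihilator]
    intro w hw
    exact he w hw
  obtain ⟨l, hl⟩ := hf
  let l' : StrongDual ℂ (LinearMap.range D) :=
    LinearMap.toContinuousLinearMap (l ∘ₗ (LinearMap.range D).subtype)
  obtain ⟨m, hm⟩ := ((InnerProductSpace.toDual ℂ (LinearMap.range D)).symm l').2
  refine ⟨m, fun w => ?_⟩
  have h1 : l (D w) = inner ℂ (T e) (T w) := LinearMap.congr_fun hl w
  have h2 := InnerProductSpace.toDual_symm_apply (x := ⟨D w, w, rfl⟩) (y := l')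
  rw [← h1, hm]
  exact h2.symm

theorem norm_sub_constrained_projection_le (T : R →ₗ[ℂ] H) (D : R →ₗ[ℂ] G) (u : H) (g : G)
    (c : ℝ)
    (hc : ∀ q m e : R, (∀ w, inner ℂ (T w) (u - T q) = 0) →
      (∀ w, inner ℂ (T e) (T w) = inner ℂ (D m) (D w)) →
      ‖inner ℂ (D m) (g - D q)‖ ≤ c * ‖T e‖ * ‖u - T q‖)
    (hc0 : 0 ≤ c)
    (r : R) (h1 : ∀ v, inner ℂ (D v) (g - D r) = 0)
    (h2 : ∀ w, D w = 0 → inner ℂ (T w) (u - T r) = 0) (q' : R) :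
    ‖u - T r‖ ≤ (1 + c) * ‖u - T q'‖ := by
  obtain ⟨q, -, hq⟩ := exists_inner_sub_eq_zero T ⊤ u
  have hq : ∀ w, inner ℂ (T w) (u - T q) = 0 := fun w => hq w trivial
  have he : ∀ w, D w = 0 → inner ℂ (T (r - q)) (T w) = 0 := by
    intro w hw
    rw [inner_eq_zero_symm]
    have e : T (r - q) = (u - T q) - (u - T r) := by rw [map_sub]; abel
    rw [e, inner_sub_right, hq, h2 w hw, sub_zero]
  obtain ⟨m, hm⟩ := exists_inner_eq_inner_of_orthogonal_ker T D (r - q) he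
  have hcm := hc q m (r - q) hq hm
  have e1 : inner ℂ (D m) (g - D q) = inner ℂ (T (r - q)) (T (r - q)) := by
    rw [hm, map_sub]
    have : g - D q = (g - D r) + (D r - D q) := by abel
    rw [this, inner_add_right, h1, zero_add]
  rw [e1, inner_self_eq_norm_sq_to_K, norm_pow, RCLike.norm_ofReal, abs_norm, pow_two] at hcm
  have h3 : ‖T (r - q)‖ ≤ c * ‖u - T q‖ := by
    rcases (norm_nonneg (T (r - q))).eq_or_lt with h0 | h0
    · rw [← h0]; positivity
    · exact le_of_mul_le_mul_right (by linarith) h0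
  have h4 : ‖u - T q‖ ≤ ‖u - T q'‖ := by
    have e : u - T q' = (u - T q) + T (q - q') := by rw [map_sub]; abel
    have ho : inner ℂ (u - T q) (T (q - q')) = 0 := by rw [inner_eq_zero_symm]; exact hq _
    have := norm_add_sq_eq_norm_sq_add_norm_sq_of_inner_eq_zero (𝕜 := ℂ) _ _ ho
    rw [← e] at this
    nlinarith [norm_nonneg (u - T q), norm_nonneg (u - T q'), norm_nonneg (T (q - q'))]
  calc ‖u - T r‖ = ‖(u - T q) - T (r - q)‖ := by congr 1; rw [map_sub]; abel
    _ ≤ ‖u - T q‖ + ‖T (r - q)‖ := norm_sub_le _ _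
    _ ≤ (1 + c) * ‖u - T q‖ := by linarith
    _ ≤ (1 + c) * ‖u - T q'‖ := by gcongr

end ConstrainedProjection

section PartialDerivatives

theorem hasDerivAt_pd1 {f : ℝ × ℝ → ℂ} {x y : ℝ} (hf : DifferentiableAt ℝ f (x, y)) :
    HasDerivAt (fun s => f (s, y)) (pd1 f (x, y)) x := by
  have h : HasDerivAt (fun s : ℝ => (s, y)) ((1 : ℝ), (0 : ℝ)) x :=
    (hasDerivAt_id x).prodMk (hasDerivAt_const x y)
  exact hf.hasFDerivAt.comp_hasDerivAt x h

theorem hasDerivAt_pd2 {f : ℝ × ℝ → ℂ} {x y : ℝ} (hf : DifferentiableAt ℝ f (x, y)) :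
    HasDerivAt (fun s => f (x, s)) (pd2 f (x, y)) y := by
  have h : HasDerivAt (fun s : ℝ => (x, s)) ((0 : ℝ), (1 : ℝ)) y :=
    (hasDerivAt_const y x).prodMk (hasDerivAt_id y)
  exact hf.hasFDerivAt.comp_hasDerivAt y h

theorem pd1_comp_swap {f : ℝ × ℝ → ℂ} {x : ℝ × ℝ} (hf : DifferentiableAt ℝ f x.swap) :
    pd1 (fun y => f y.swap) x = pd2 f x.swap := by
  have h : HasFDerivAt (fun y : ℝ × ℝ => y.swap)
      (ContinuousLinearEquiv.prodComm ℝ ℝ ℝ : ℝ × ℝ →L[ℝ] ℝ × ℝ) x :=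
    (ContinuousLinearEquiv.prodComm ℝ ℝ ℝ).hasFDerivAt
  have h2 := hf.hasFDerivAt.comp x h
  have h3 : fderiv ℝ (fun y => f y.swap) x = _ := h2.fderiv
  rw [pd1, pd2, h3]
  rfl

theorem pd1_add {f g : ℝ × ℝ → ℂ} {x : ℝ × ℝ} (hf : DifferentiableAt ℝ f x)
    (hg : DifferentiableAt ℝ g x) : pd1 (fun y => f y + g y) x = pd1 f x + pd1 g x := by
  simp [pd1, fderiv_fun_add hf hg]

theorem pd2_add {f g : ℝ × ℝ → ℂ} {x : ℝ × ℝ} (hf : DifferentiableAt ℝ f x)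
    (hg : DifferentiableAt ℝ g x) : pd2 (fun y => f y + g y) x = pd2 f x + pd2 g x := by
  simp [pd2, fderiv_fun_add hf hg]

theorem pd1_sub {f g : ℝ × ℝ → ℂ} {x : ℝ × ℝ} (hf : DifferentiableAt ℝ f x)
    (hg : DifferentiableAt ℝ g x) : pd1 (fun y => f y - g y) x = pd1 f x - pd1 g x := by
  simp [pd1, fderiv_fun_sub hf hg]

theorem pd2_sub {f g : ℝ × ℝ → ℂ} {x : ℝ × ℝ} (hf : DifferentiableAt ℝ f x)
    (hg : DifferentiableAt ℝ g x) : pd2 (fun y => f y - g y) x = pd2 f x - pd2 g x := by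
  simp [pd2, fderiv_fun_sub hf hg]

theorem pd1_const_mul {f : ℝ × ℝ → ℂ} {x : ℝ × ℝ} (hf : DifferentiableAt ℝ f x) (c : ℂ) :
    pd1 (fun y => c * f y) x = c * pd1 f x := by
  simp [pd1, fderiv_const_mul hf c]

theorem pd2_const_mul {f : ℝ × ℝ → ℂ} {x : ℝ × ℝ} (hf : DifferentiableAt ℝ f x) (c : ℂ) :
    pd2 (fun y => c * f y) x = c * pd2 f x := by
  simp [pd2, fderiv_const_mul hf c]

theorem pd1_neg (f : ℝ × ℝ → ℂ) (x : ℝ × ℝ) : pd1 (fun y => -f y) x = -pd1 f x := by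
  simp [pd1, fderiv_fun_neg]

theorem pd2_neg (f : ℝ × ℝ → ℂ) (x : ℝ × ℝ) : pd2 (fun y => -f y) x = -pd2 f x := by
  simp [pd2, fderiv_fun_neg]

theorem pd1_mul_conj {f g : ℝ × ℝ → ℂ} {x : ℝ × ℝ} (hf : DifferentiableAt ℝ f x)
    (hg : DifferentiableAt ℝ g x) :
    pd1 (fun y => f y * starRingEnd ℂ (g y)) x
      = pd1 f x * starRingEnd ℂ (g x) + f x * starRingEnd ℂ (pd1 g x) := by
  have h := (hf.hasFDerivAt.mul (hg.hasFDerivAt.star)).fderiv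
  have h' : fderiv ℝ (fun y => f y * starRingEnd ℂ (g y)) x = _ := h
  rw [pd1, h']
  simp [pd1]
  ring

theorem pd2_mul_conj {f g : ℝ × ℝ → ℂ} {x : ℝ × ℝ} (hf : DifferentiableAt ℝ f x)
    (hg : DifferentiableAt ℝ g x) :
    pd2 (fun y => f y * starRingEnd ℂ (g y)) x
      = pd2 f x * starRingEnd ℂ (g x) + f x * starRingEnd ℂ (pd2 g x) := by
  have h := (hf.hasFDerivAt.mul (hg.hasFDerivAt.star)).fderiv
  have h' : fderiv ℝ (fun y => f y * starRingEnd ℂ (g y)) x = _ := h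
  rw [pd2, h']
  simp [pd2]
  ring

theorem pd1_pd2_comm {f : ℝ × ℝ → ℂ} (hf : ContDiff ℝ 2 f) (x : ℝ × ℝ) :
    pd1 (pd2 f) x = pd2 (pd1 f) x := by
  have h := (hf.contDiffAt (x := x)).isSymmSndFDerivAt (by simp)
  have hd : DifferentiableAt ℝ (fderiv ℝ f) x :=
    ((hf.fderiv_right (m := 1) (by norm_num)).differentiable (by simp)) x
  have e : ∀ v w : ℝ × ℝ, fderiv ℝ (fun y => fderiv ℝ f y v) x w
      = fderiv ℝ (fderiv ℝ f) x w v := by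
    intro v w
    rw [fderiv_clm_apply hd (differentiableAt_const v)]
    simp
  change fderiv ℝ (fun y => fderiv ℝ f y (0, 1)) x (1, 0)
    = fderiv ℝ (fun y => fderiv ℝ f y (1, 0)) x (0, 1)
  rw [e, e]
  exact h _ _

end PartialDerivatives

section BivariatePolynomials

variable {p₁ p₂ : ℕ} {f g : ℝ × ℝ → ℂ}

/-- The bivariate polynomial function with a given array of coefficients. -/
def poly2OfCoeff (p₁ p₂ : ℕ) :
    (Fin (p₁ + 1) → Fin (p₂ + 1) → ℂ) →ₗ[ℂ] (ℝ × ℝ → ℂ) where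
  toFun c x := ∑ i, ∑ j, c i j * (x.1 : ℂ) ^ (i : ℕ) * (x.2 : ℂ) ^ (j : ℕ)
  map_add' c d := by
    funext x
    simp [add_mul, Finset.sum_add_distrib]
  map_smul' a c := by
    funext x
    simp [Finset.mul_sum, mul_assoc]

theorem isPoly2_iff_mem_range : IsPoly2 p₁ p₂ f ↔ f ∈ LinearMap.range (poly2OfCoeff p₁ p₂) :=
  ⟨fun ⟨c, hc⟩ => ⟨c, funext fun x => (hc x).symm⟩,
    fun ⟨c, hc⟩ => ⟨c, fun x => (congrFun hc x).symm⟩⟩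

theorem IsPoly2.add (hf : IsPoly2 p₁ p₂ f) (hg : IsPoly2 p₁ p₂ g) :
    IsPoly2 p₁ p₂ (fun x => f x + g x) := by
  rw [isPoly2_iff_mem_range] at *
  exact add_mem hf hg

theorem IsPoly2.const_mul (c : ℂ) (hf : IsPoly2 p₁ p₂ f) :
    IsPoly2 p₁ p₂ (fun x => c * f x) := by
  rw [isPoly2_iff_mem_range] at *
  exact Submodule.smul_mem _ c hf

theorem IsPoly2.neg (hf : IsPoly2 p₁ p₂ f) : IsPoly2 p₁ p₂ (fun x => -f x) := by
  simpa using hf.const_mul (-1)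

theorem isPoly2_zero : IsPoly2 p₁ p₂ (fun _ => 0) :=
  isPoly2_iff_mem_range.2 (zero_mem _)

theorem IsPoly2.sum {ι : Type*} {s : Finset ι} {F : ι → ℝ × ℝ → ℂ}
    (h : ∀ i ∈ s, IsPoly2 p₁ p₂ (F i)) : IsPoly2 p₁ p₂ (fun x => ∑ i ∈ s, F i x) := by
  rw [isPoly2_iff_mem_range]
  have : (fun x => ∑ i ∈ s, F i x) = ∑ i ∈ s, F i := by
    funext x
    simp
  rw [this]
  exact sum_mem fun i hi => isPoly2_iff_mem_range.1 (h i hi)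

theorem isPoly2_monomial (c : ℂ) {i j : ℕ} (hi : i ≤ p₁) (hj : j ≤ p₂) :
    IsPoly2 p₁ p₂ (fun x => c * (x.1 : ℂ) ^ i * (x.2 : ℂ) ^ j) := by
  classical
  refine ⟨fun k l => if (k : ℕ) = i ∧ (l : ℕ) = j then c else 0, fun x => ?_⟩
  rw [Finset.sum_eq_single ⟨i, Nat.lt_succ_of_le hi⟩,
    Finset.sum_eq_single ⟨j, Nat.lt_succ_of_le hj⟩]
  · simp
  · intro b _ hb
    dsimp only
    rw [if_neg, zero_mul, zero_mul]
    exact fun h => hb (Fin.ext h.2)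
  · simp
  · intro b _ hb
    refine Finset.sum_eq_zero fun l _ => ?_
    dsimp only
    rw [if_neg, zero_mul, zero_mul]
    exact fun h => hb (Fin.ext h.1)
  · simp

theorem IsPoly2.of_le {q₁ q₂ : ℕ} (h₁ : p₁ ≤ q₁) (h₂ : p₂ ≤ q₂) (hf : IsPoly2 p₁ p₂ f) :
    IsPoly2 q₁ q₂ f := by
  obtain ⟨c, hc⟩ := hf
  rw [funext hc]
  exact IsPoly2.sum fun i _ => IsPoly2.sum fun j _ =>
    isPoly2_monomial _ (by omega) (by omega)

theorem IsPoly2.contDiff {n : WithTop ℕ∞} (hf : IsPoly2 p₁ p₂ f) : ContDiff ℝ n f := by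
  obtain ⟨c, hc⟩ := hf
  rw [funext hc]
  have h1 : ContDiff ℝ n (fun x : ℝ × ℝ => (x.1 : ℂ)) :=
    Complex.ofRealCLM.contDiff.comp contDiff_fst
  have h2 : ContDiff ℝ n (fun x : ℝ × ℝ => (x.2 : ℂ)) :=
    Complex.ofRealCLM.contDiff.comp contDiff_snd
  exact ContDiff.sum fun i _ => ContDiff.sum fun j _ =>
    (contDiff_const.mul (h1.pow _)).mul (h2.pow _)

theorem IsPoly2.continuous (hf : IsPoly2 p₁ p₂ f) : Continuous f :=
  (hf.contDiff (n := 0)).continuous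

theorem IsPoly2.differentiable (hf : IsPoly2 p₁ p₂ f) : Differentiable ℝ f :=
  (hf.contDiff (n := 1)).differentiable (by simp)

theorem IsPoly2.comp_swap (hf : IsPoly2 p₁ p₂ f) : IsPoly2 p₂ p₁ (fun x => f x.swap) := by
  obtain ⟨c, hc⟩ := hf
  rw [funext hc]
  refine IsPoly2.sum fun i _ => IsPoly2.sum fun j _ => ?_
  have e : (fun x : ℝ × ℝ => c i j * (x.swap.1 : ℂ) ^ (i : ℕ) * (x.swap.2 : ℂ) ^ (j : ℕ))
      = fun x => c i j * (x.1 : ℂ) ^ (j : ℕ) * (x.2 : ℂ) ^ (i : ℕ) := by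
    funext x
    simp only [Prod.fst_swap, Prod.snd_swap]
    ring
  rw [e]
  exact isPoly2_monomial _ (by omega) (by omega)

theorem IsPoly2.pd1 (hf : IsPoly2 p₁ p₂ f) : IsPoly2 (p₁ - 1) p₂ (pd1 f) := by
  have hd := hf.differentiable
  obtain ⟨c, hc⟩ := hf
  have e : _root_.pd1 f = fun x => ∑ i, ∑ j,
      (c i j * (i : ℕ)) * (x.1 : ℂ) ^ ((i : ℕ) - 1) * (x.2 : ℂ) ^ (j : ℕ) := by
    funext ⟨x, y⟩
    have h1 := hasDerivAt_pd1 (hd (x, y))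
    have h2 : HasDerivAt (fun s => f (s, y)) (∑ i, ∑ j,
        (c i j * (i : ℕ)) * (x : ℂ) ^ ((i : ℕ) - 1) * (y : ℂ) ^ (j : ℕ)) x := by
      simp_rw [hc]
      refine HasDerivAt.fun_sum fun i _ => HasDerivAt.fun_sum fun j _ => ?_
      have := ((hasDerivAt_pow (i : ℕ) (x : ℂ)).comp_ofReal.const_mul (c i j)).mul_const
        ((y : ℂ) ^ (j : ℕ))
      refine this.congr_deriv ?_
      ring
    exact h1.unique h2
  rw [e]
  exact IsPoly2.sum fun i _ => IsPoly2.sum fun j _ =>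
    isPoly2_monomial _ (by omega) (by omega)

theorem IsPoly2.pd2 (hf : IsPoly2 p₁ p₂ f) : IsPoly2 p₁ (p₂ - 1) (pd2 f) := by
  have h := hf.comp_swap.pd1.comp_swap
  have e : (fun x : ℝ × ℝ => _root_.pd1 (fun y => f y.swap) x.swap) = _root_.pd2 f := by
    funext x
    rw [pd1_comp_swap (hf.differentiable _), Prod.swap_swap]
  rwa [e] at h

/-- Antiderivative in the second variable. -/
theorem IsPoly2.exists_pd2_eq (hf : IsPoly2 p₁ p₂ f) :
    ∃ φ, IsPoly2 p₁ (p₂ + 1) φ ∧ _root_.pd2 φ = f ∧ ∀ x, φ (x, 0) = 0 := by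
  obtain ⟨c, hc⟩ := hf
  set φ : ℝ × ℝ → ℂ := fun x => ∑ i, ∑ j,
    (c i j / ((j : ℕ) + 1)) * (x.1 : ℂ) ^ (i : ℕ) * (x.2 : ℂ) ^ ((j : ℕ) + 1) with hφ
  have hP : IsPoly2 p₁ (p₂ + 1) φ := IsPoly2.sum fun i _ => IsPoly2.sum fun j _ =>
    isPoly2_monomial _ (by omega) (by omega)
  refine ⟨φ, hP, ?_, fun x => ?_⟩
  · funext ⟨x, y⟩
    have h1 := hasDerivAt_pd2 (hP.differentiable (x, y))
    have h2 : HasDerivAt (fun s => φ (x, s)) (f (x, y)) y := by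
      rw [hc]
      refine HasDerivAt.fun_sum fun i _ => HasDerivAt.fun_sum fun j _ => ?_
      have := (hasDerivAt_pow ((j : ℕ) + 1) (y : ℂ)).comp_ofReal.const_mul
        (c i j / ((j : ℕ) + 1) * (x : ℂ) ^ (i : ℕ))
      refine this.congr_deriv ?_
      have : ((j : ℕ) : ℂ) + 1 ≠ 0 := Nat.cast_add_one_ne_zero _
      push_cast
      field_simp
    exact h1.unique h2
  · simp [hφ]

/-- Restrictions of bivariate polynomials to horizontal lines. -/
theorem IsPoly2.exists_slice (hf : IsPoly2 p₁ p₂ f) (y : ℝ) :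
    ∃ P Q : Polynomial ℝ, P.natDegree ≤ p₁ ∧ Q.natDegree ≤ p₁ ∧
      ∀ x, f (x, y) = ((P.eval x : ℝ) : ℂ) + ((Q.eval x : ℝ) : ℂ) * Complex.I := by
  obtain ⟨c, hc⟩ := hf
  have hdeg : ∀ d : Fin (p₁ + 1) → ℝ,
      (∑ i, Polynomial.C (d i) * Polynomial.X ^ (i : ℕ)).natDegree ≤ p₁ := fun d =>
    Polynomial.natDegree_sum_le_of_forall_le _ _ fun i _ =>
      (Polynomial.natDegree_C_mul_X_pow_le _ _).trans (by omega)
  refine ⟨_, _, hdeg fun i => (∑ j, c i j * (y : ℂ) ^ (j : ℕ)).re,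
    hdeg fun i => (∑ j, c i j * (y : ℂ) ^ (j : ℕ)).im, fun x => ?_⟩
  simp only [Polynomial.eval_finsetSum, Polynomial.eval_mul, Polynomial.eval_C,
    Polynomial.eval_pow, Polynomial.eval_X, Complex.ofReal_sum, Complex.ofReal_mul,
    Complex.ofReal_pow]
  rw [hc, Finset.sum_mul, ← Finset.sum_add_distrib]
  refine Finset.sum_congr rfl fun i _ => ?_
  have e : ∑ j, c i j * (x : ℂ) ^ (i : ℕ) * (y : ℂ) ^ (j : ℕ)
      = (∑ j, c i j * (y : ℂ) ^ (j : ℕ)) * (x : ℂ) ^ (i : ℕ) := by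
    rw [Finset.sum_mul]
    exact Finset.sum_congr rfl fun j _ => by ring
  dsimp only
  rw [e]
  conv_lhs => rw [← Complex.re_add_im (∑ j, c i j * (y : ℂ) ^ (j : ℕ))]
  ring

/-- Partial moments of a bivariate polynomial, tensorized with a polynomial in the first
variable. -/
theorem IsPoly2.mul_integral (hf : IsPoly2 p₁ p₂ f) (a : Polynomial ℝ) {q : ℕ}
    (ha : a.natDegree ≤ q) :
    IsPoly2 q p₂ (fun x =>
      ((a.eval x.1 : ℝ) : ℂ) * ∫ s in (0 : ℝ)..1, f (s, x.2) * ((a.eval s : ℝ) : ℂ)) := by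
  obtain ⟨c, hc⟩ := hf
  have e : (fun x : ℝ × ℝ =>
      ((a.eval x.1 : ℝ) : ℂ) * ∫ s in (0 : ℝ)..1, f (s, x.2) * ((a.eval s : ℝ) : ℂ))
      = fun x => ∑ k ∈ Finset.range (q + 1), ∑ i : Fin (p₁ + 1), ∑ j : Fin (p₂ + 1),
        ((a.coeff k : ℂ) * (c i j * ∫ s in (0 : ℝ)..1, (s : ℂ) ^ (i : ℕ) * ((a.eval s : ℝ) : ℂ)))
          * (x.1 : ℂ) ^ k * (x.2 : ℂ) ^ (j : ℕ) := by
    funext x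
    have ha' : Continuous fun s : ℝ => ((a.eval s : ℝ) : ℂ) :=
      Complex.continuous_ofReal.comp a.continuous
    have h1 : ∫ s in (0 : ℝ)..1, f (s, x.2) * ((a.eval s : ℝ) : ℂ)
        = ∑ i : Fin (p₁ + 1), ∑ j : Fin (p₂ + 1),
          (c i j * ∫ s in (0 : ℝ)..1, (s : ℂ) ^ (i : ℕ) * ((a.eval s : ℝ) : ℂ))
            * (x.2 : ℂ) ^ (j : ℕ) := by
      have e1 : ∀ s : ℝ, f (s, x.2) * ((a.eval s : ℝ) : ℂ) = ∑ i : Fin (p₁ + 1), ∑ j : Fin (p₂ + 1),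
          (c i j * (x.2 : ℂ) ^ (j : ℕ)) * ((s : ℂ) ^ (i : ℕ) * ((a.eval s : ℝ) : ℂ)) := by
        intro s
        rw [hc, Finset.sum_mul]
        refine Finset.sum_congr rfl fun i _ => ?_
        rw [Finset.sum_mul]
        exact Finset.sum_congr rfl fun j _ => by ring
      simp_rw [e1]
      rw [intervalIntegral.integral_finsetSum fun i _ => by
        apply Continuous.intervalIntegrable; fun_prop]
      refine Finset.sum_congr rfl fun i _ => ?_
      rw [intervalIntegral.integral_finsetSum fun i _ => by
        apply Continuous.intervalIntegrable; fun_prop]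
      refine Finset.sum_congr rfl fun j _ => ?_
      rw [intervalIntegral.integral_const_mul]
      ring
    rw [h1, Polynomial.eval_eq_sum_range' (Nat.lt_succ_of_le ha)]
    push_cast
    rw [Finset.sum_mul]
    refine Finset.sum_congr rfl fun k _ => ?_
    rw [Finset.mul_sum]
    refine Finset.sum_congr rfl fun i _ => ?_
    rw [Finset.mul_sum]
    exact Finset.sum_congr rfl fun j _ => by ring
  rw [e]
  exact IsPoly2.sum fun k hk => IsPoly2.sum fun i _ => IsPoly2.sum fun j _ =>
    isPoly2_monomial _ (by rw [Finset.mem_range] at hk; omega) (by omega)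

end BivariatePolynomials

section UnitSquare

theorem closure_Ksq : closure Ksq = Set.Icc (0 : ℝ) 1 ×ˢ Set.Icc (0 : ℝ) 1 := by
  rw [Ksq, closure_prod_eq, closure_Ioo zero_ne_one]

theorem isOpen_Ksq : IsOpen Ksq := isOpen_Ioo.prod isOpen_Ioo

theorem isCompact_closure_Ksq : IsCompact (closure Ksq) := by
  rw [closure_Ksq]
  exact isCompact_Icc.prod isCompact_Icc

instance isFiniteMeasure_restrict_Ksq : IsFiniteMeasure (volume.restrict Ksq) :=
  ⟨by
    rw [Measure.restrict_apply_univ]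
    exact (measure_mono subset_closure).trans_lt isCompact_closure_Ksq.measure_lt_top⟩

theorem memLp_Ksq {E : Type*} [NormedAddCommGroup E] [SecondCountableTopology E]
    {f : ℝ × ℝ → E} (hf : ContinuousOn f (closure Ksq)) (q : ENNReal) :
    MemLp f q (volume.restrict Ksq) := by
  obtain ⟨C, hC⟩ := isCompact_closure_Ksq.exists_bound_of_continuousOn hf
  refine MemLp.of_bound ?_ C ?_
  · borelize E
    exact (hf.mono subset_closure).aestronglyMeasurable isOpen_Ksq.measurableSet
  · exact (ae_restrict_iff' isOpen_Ksq.measurableSet).2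
      (Filter.Eventually.of_forall fun x hx => hC x (subset_closure hx))

theorem integrableOn_Ksq {E : Type*} [NormedAddCommGroup E]
    {f : ℝ × ℝ → E} (hf : ContinuousOn f (closure Ksq)) : IntegrableOn f Ksq :=
  (hf.integrableOn_compact isCompact_closure_Ksq).mono_set subset_closure

theorem setIntegral_Ksq_swap {E : Type*} [NormedAddCommGroup E] [NormedSpace ℝ E]
    (f : ℝ × ℝ → E) : ∫ x in Ksq, f x.swap = ∫ x in Ksq, f x :=
  setIntegral_prod_swap (Set.Ioo (0 : ℝ) 1) (Set.Ioo (0 : ℝ) 1) f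

theorem setIntegral_Ksq {E : Type*} [NormedAddCommGroup E] [NormedSpace ℝ E]
    {f : ℝ × ℝ → E} (hf : Continuous f) :
    ∫ x in Ksq, f x = ∫ y in (0 : ℝ)..1, ∫ x in (0 : ℝ)..1, f (x, y) := by
  rw [← setIntegral_Ksq_swap]
  have hi : IntegrableOn (fun x : ℝ × ℝ => f x.swap) Ksq :=
    integrableOn_Ksq (hf.comp continuous_swap).continuousOn
  have h := setIntegral_prod (μ := (volume : Measure ℝ)) (ν := (volume : Measure ℝ))
    (fun x : ℝ × ℝ => f x.swap) (s := Set.Ioo (0 : ℝ) 1) (t := Set.Ioo (0 : ℝ) 1) hi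
  simp only [intervalIntegral.integral_of_le zero_le_one, integral_Ioc_eq_integral_Ioo]
  exact h

/-- Divergence theorem on the unit square for fields with vanishing normal trace. -/
theorem setIntegral_Ksq_div_eq_zero {F G : ℝ × ℝ → ℂ} (hF : ContinuousOn F (closure Ksq))
    (hG : ContinuousOn G (closure Ksq)) (hF' : ∀ x ∈ Ksq, DifferentiableAt ℝ F x)
    (hG' : ∀ x ∈ Ksq, DifferentiableAt ℝ G x)
    (hi : IntegrableOn (fun x => pd1 F x + pd2 G x) Ksq)
    (hb : ∀ t ∈ Set.Icc (0 : ℝ) 1, F (0, t) = 0 ∧ F (1, t) = 0 ∧ G (t, 0) = 0 ∧ G (t, 1) = 0) :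
    ∫ x in Ksq, (pd1 F x + pd2 G x) = 0 := by
  have hI : closure Ksq = Set.Icc ((0 : ℝ), (0 : ℝ)) (1, 1) := by
    rw [closure_Ksq, Set.Icc_prod_Icc]
  have hae : Ksq =ᵐ[volume] Set.Icc ((0 : ℝ), (0 : ℝ)) (1, 1) := by
    rw [← Set.Icc_prod_Icc, Ksq]
    exact Measure.set_prod_ae_eq Ioo_ae_eq_Icc Ioo_ae_eq_Icc
  rw [setIntegral_congr_set hae]
  rw [hI] at hF hG
  have h := integral_divergence_prod_Icc_of_hasFDerivAt_of_le F G (fderiv ℝ F) (fderiv ℝ G)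
    ((0 : ℝ), (0 : ℝ)) (1, 1) (by simp) hF hG
    (fun x hx => (hF' x hx).hasFDerivAt) (fun x hx => (hG' x hx).hasFDerivAt)
    (hi.congr_set_ae hae.symm)
  refine h.trans ?_
  have z : ∀ g : ℝ → ℂ, (∀ t ∈ Set.Icc (0 : ℝ) 1, g t = 0) → ∫ t in (0 : ℝ)..1, g t = 0 := by
    intro g hg
    rw [intervalIntegral.integral_congr (g := fun _ => 0)]
    · simp
    · intro t ht
      exact hg t (by rwa [Set.uIcc_of_le zero_le_one] at ht)
  dsimp only
  rw [z _ fun t ht => (hb t ht).1, z _ fun t ht => (hb t ht).2.1, z _ fun t ht => (hb t ht).2.2.1,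
    z _ fun t ht => (hb t ht).2.2.2]
  simp

/-- Functions that are continuously differentiable up to the boundary of the unit square. -/
def IsC1Ksq {E : Type*} [NormedAddCommGroup E] [NormedSpace ℝ E] (f : ℝ × ℝ → E) : Prop :=
  ∃ U, IsOpen U ∧ closure Ksq ⊆ U ∧ ContDiffOn ℝ 1 f U

section IsC1Ksq

variable {f g : ℝ × ℝ → ℂ}

theorem IsPoly2.isC1Ksq {p₁ p₂ : ℕ} (hf : IsPoly2 p₁ p₂ f) : IsC1Ksq f :=
  ⟨Set.univ, isOpen_univ, Set.subset_univ _, hf.contDiff.contDiffOn⟩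

theorem IsC1Ksq.sub (hf : IsC1Ksq f) (hg : IsC1Ksq g) : IsC1Ksq (fun x => f x - g x) := by
  obtain ⟨U, hU, hKU, hfU⟩ := hf
  obtain ⟨V, hV, hKV, hgV⟩ := hg
  exact ⟨U ∩ V, hU.inter hV, Set.subset_inter hKU hKV,
    (hfU.mono Set.inter_subset_left).sub (hgV.mono Set.inter_subset_right)⟩

theorem IsC1Ksq.fst {u : ℝ × ℝ → ℂ × ℂ} (hu : IsC1Ksq u) : IsC1Ksq (fun x => (u x).1) := by
  obtain ⟨U, hU, hKU, hfU⟩ := hu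
  exact ⟨U, hU, hKU, contDiff_fst.comp_contDiffOn hfU⟩

theorem IsC1Ksq.snd {u : ℝ × ℝ → ℂ × ℂ} (hu : IsC1Ksq u) : IsC1Ksq (fun x => (u x).2) := by
  obtain ⟨U, hU, hKU, hfU⟩ := hu
  exact ⟨U, hU, hKU, contDiff_snd.comp_contDiffOn hfU⟩

theorem IsC1Ksq.continuousOn (hf : IsC1Ksq f) : ContinuousOn f (closure Ksq) := by
  obtain ⟨U, hU, hKU, hfU⟩ := hf
  exact hfU.continuousOn.mono hKU

theorem IsC1Ksq.differentiableAt (hf : IsC1Ksq f) {x : ℝ × ℝ} (hx : x ∈ closure Ksq) :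
    DifferentiableAt ℝ f x := by
  obtain ⟨U, hU, hKU, hfU⟩ := hf
  exact (hfU.differentiableOn (by simp)).differentiableAt (hU.mem_nhds (hKU hx))

theorem IsC1Ksq.continuousOn_fderiv (hf : IsC1Ksq f) :
    ContinuousOn (fderiv ℝ f) (closure Ksq) := by
  obtain ⟨U, hU, hKU, hfU⟩ := hf
  exact (hfU.continuousOn_fderiv_of_isOpen hU (by simp)).mono hKU

theorem IsC1Ksq.continuousOn_pd1 (hf : IsC1Ksq f) : ContinuousOn (pd1 f) (closure Ksq) :=
  hf.continuousOn_fderiv.clm_apply continuousOn_const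

theorem IsC1Ksq.continuousOn_pd2 (hf : IsC1Ksq f) : ContinuousOn (pd2 f) (closure Ksq) :=
  hf.continuousOn_fderiv.clm_apply continuousOn_const

theorem ContinuousOn.conj {s : Set (ℝ × ℝ)} (hf : ContinuousOn f s) :
    ContinuousOn (fun x => starRingEnd ℂ (f x)) s :=
  Complex.continuous_conj.comp_continuousOn hf

/-- Integration by parts: the divergence is minus the adjoint of the gradient. -/
theorem ip0_vdiv_eq_neg_ip2_sgrad {w : ℝ × ℝ → ℂ × ℂ} (h1 : IsC1Ksq fun x => (w x).1)
    (h2 : IsC1Ksq fun x => (w x).2) (hg : IsC1Ksq g)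
    (hb : ∀ t ∈ Set.Icc (0 : ℝ) 1,
      (w (0, t)).1 = 0 ∧ (w (1, t)).1 = 0 ∧ (w (t, 0)).2 = 0 ∧ (w (t, 1)).2 = 0) :
    ip0 (vdiv w) g = -ip2 w (sgrad g) := by
  have hc1 : ContinuousOn (fun x => vdiv w x * starRingEnd ℂ (g x)) (closure Ksq) :=
    (h1.continuousOn_pd1.add h2.continuousOn_pd2).mul hg.continuousOn.conj
  have hc2 : ContinuousOn (fun x => (w x).1 * starRingEnd ℂ (pd1 g x)
      + (w x).2 * starRingEnd ℂ (pd2 g x)) (closure Ksq) :=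
    (h1.continuousOn.mul hg.continuousOn_pd1.conj).add
      (h2.continuousOn.mul hg.continuousOn_pd2.conj)
  have heq : Set.EqOn (fun x => pd1 (fun y => (w y).1 * starRingEnd ℂ (g y)) x
      + pd2 (fun y => (w y).2 * starRingEnd ℂ (g y)) x)
      (fun x => vdiv w x * starRingEnd ℂ (g x) + ((w x).1 * starRingEnd ℂ (pd1 g x)
      + (w x).2 * starRingEnd ℂ (pd2 g x))) Ksq := by
    intro x hx
    have hx' := subset_closure hx
    dsimp only
    rw [pd1_mul_conj (h1.differentiableAt hx') (hg.differentiableAt hx'),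
      pd2_mul_conj (h2.differentiableAt hx') (hg.differentiableAt hx'), vdiv]
    ring
  have hd := setIntegral_Ksq_div_eq_zero (F := fun y => (w y).1 * starRingEnd ℂ (g y))
    (G := fun y => (w y).2 * starRingEnd ℂ (g y)) (h1.continuousOn.mul hg.continuousOn.conj)
    (h2.continuousOn.mul hg.continuousOn.conj)
    (fun x hx => (h1.differentiableAt (subset_closure hx)).mul
      (hg.differentiableAt (subset_closure hx)).star)
    (fun x hx => (h2.differentiableAt (subset_closure hx)).mul
      (hg.differentiableAt (subset_closure hx)).star)
    ((integrableOn_congr_fun heq isOpen_Ksq.measurableSet).2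
      (integrableOn_Ksq (hc1.add hc2)))
    (fun t ht => by
      obtain ⟨b1, b2, b3, b4⟩ := hb t ht
      simp [b1, b2, b3, b4])
  rw [setIntegral_congr_fun isOpen_Ksq.measurableSet heq,
    integral_add (integrableOn_Ksq hc1) (integrableOn_Ksq hc2)] at hd
  exact eq_neg_of_add_eq_zero_left hd

/-- A curl-free field is orthogonal to the curls of functions vanishing on the boundary. -/
theorem ip2_scurl_eq_zero {u : ℝ × ℝ → ℂ × ℂ} (h1 : IsC1Ksq fun x => (u x).1)
    (h2 : IsC1Ksq fun x => (u x).2) (hg : IsC1Ksq g)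
    (hcurl : ∀ x ∈ Ksq, pd1 (fun y => (u y).2) x - pd2 (fun y => (u y).1) x = 0)
    (hb : ∀ t ∈ Set.Icc (0 : ℝ) 1,
      g (t, 0) = 0 ∧ g (t, 1) = 0 ∧ g (0, t) = 0 ∧ g (1, t) = 0) :
    ip2 u (scurl g) = 0 := by
  have hc : ContinuousOn (fun x => (u x).1 * starRingEnd ℂ (pd2 g x)
      + (u x).2 * starRingEnd ℂ (-pd1 g x)) (closure Ksq) :=
    (h1.continuousOn.mul hg.continuousOn_pd2.conj).add
      (h2.continuousOn.mul hg.continuousOn_pd1.neg.conj)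
  have heq : Set.EqOn (fun x => pd1 (fun y => -((u y).2 * starRingEnd ℂ (g y))) x
      + pd2 (fun y => (u y).1 * starRingEnd ℂ (g y)) x)
      (fun x => (u x).1 * starRingEnd ℂ (pd2 g x) + (u x).2 * starRingEnd ℂ (-pd1 g x)) Ksq := by
    intro x hx
    have hx' := subset_closure hx
    dsimp only
    rw [pd1_neg, pd1_mul_conj (h2.differentiableAt hx') (hg.differentiableAt hx'),
      pd2_mul_conj (h1.differentiableAt hx') (hg.differentiableAt hx'), map_neg]
    linear_combination (-starRingEnd ℂ (g x)) * hcurl x hx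
  have hd := setIntegral_Ksq_div_eq_zero (F := fun y => -((u y).2 * starRingEnd ℂ (g y)))
    (G := fun y => (u y).1 * starRingEnd ℂ (g y)) (h2.continuousOn.mul hg.continuousOn.conj).neg
    (h1.continuousOn.mul hg.continuousOn.conj)
    (fun x hx => ((h2.differentiableAt (subset_closure hx)).mul
      (hg.differentiableAt (subset_closure hx)).star).neg)
    (fun x hx => (h1.differentiableAt (subset_closure hx)).mul
      (hg.differentiableAt (subset_closure hx)).star)
    ((integrableOn_congr_fun heq isOpen_Ksq.measurableSet).2 (integrableOn_Ksq hc))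
    (fun t ht => by
      obtain ⟨b1, b2, b3, b4⟩ := hb t ht
      simp [b1, b2, b3, b4])
  rw [← hd]
  exact (setIntegral_congr_fun isOpen_Ksq.measurableSet heq).symm

end IsC1Ksq

end UnitSquare

section ProjectionError

variable {p : ℕ} {e l : ℝ × ℝ → ℂ}

theorem integral_mul_eq_unitInt (P Q a : Polynomial ℝ) :
    ∫ x in (0 : ℝ)..1, (((P.eval x : ℝ) : ℂ) + ((Q.eval x : ℝ) : ℂ) * Complex.I)
      * ((a.eval x : ℝ) : ℂ) = (unitInt (P * a) : ℂ) + (unitInt (Q * a) : ℂ) * Complex.I := by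
  rw [unitInt_apply, unitInt_apply, ← intervalIntegral.integral_ofReal,
    ← intervalIntegral.integral_ofReal, ← intervalIntegral.integral_mul_const,
    ← intervalIntegral.integral_add]
  · congr 1
    funext x
    simp only [Polynomial.eval_mul, Complex.ofReal_mul]
    ring
  · exact (Complex.continuous_ofReal.comp (P * a).continuous).intervalIntegrable _ _
  · exact ((Complex.continuous_ofReal.comp (Q * a).continuous).mul
      continuous_const).intervalIntegrable _ _

theorem integral_norm_sq_eq_unitInt (P Q : Polynomial ℝ) :
    ∫ x in (0 : ℝ)..1, ‖((P.eval x : ℝ) : ℂ) + ((Q.eval x : ℝ) : ℂ) * Complex.I‖ ^ 2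
      = unitInt (P * P) + unitInt (Q * Q) := by
  rw [unitInt_apply, unitInt_apply, ← intervalIntegral.integral_add
    ((P * P).continuous.intervalIntegrable _ _) ((Q * Q).continuous.intervalIntegrable _ _)]
  congr 1
  funext x
  rw [← Complex.normSq_eq_norm_sq, Complex.normSq_add_mul_I]
  simp only [Polynomial.eval_mul]
  ring

/-- Tensorized version of `unitInt_projection_error` in the first variable. -/
theorem setIntegral_projection_error (hp : 1 ≤ p) (he : IsPoly2 p (p - 1) e)
    (hl : IsPoly2 (p - 1) (p - 1) l)
    (h : ∀ f, IsPoly2 p (p - 1) f → (∀ t ∈ Set.Icc (0 : ℝ) 1, f (0, t) = 0 ∧ f (1, t) = 0) →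
      ∫ x in Ksq, (e x + pd1 l x) * starRingEnd ℂ (f x) = 0) :
    ∫ x in Ksq, ‖e x + pd1 l x‖ ^ 2 ≤ 8 * p * ∫ x in Ksq, ‖e x‖ ^ 2 := by
  have hr : IsPoly2 p (p - 1) (fun x => e x + pd1 l x) := he.add (hl.pd1.of_le (by omega) le_rfl)
  set r : ℝ × ℝ → ℂ := fun x => e x + pd1 l x with hrdef
  have hrc : Continuous r := hr.continuous
  have hmom : ∀ a : Polynomial ℝ, a.natDegree ≤ p → a.eval 0 = 0 → a.eval 1 = 0 →
      ∀ y ∈ Set.Icc (0 : ℝ) 1, ∫ s in (0 : ℝ)..1, r (s, y) * ((a.eval s : ℝ) : ℂ) = 0 := by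
    intro a ha ha0 ha1
    set M : ℝ → ℂ := fun y => ∫ s in (0 : ℝ)..1, r (s, y) * ((a.eval s : ℝ) : ℂ) with hM
    have hac : Continuous fun s : ℝ => ((a.eval s : ℝ) : ℂ) :=
      Complex.continuous_ofReal.comp a.continuous
    have hMc : Continuous M := by
      apply intervalIntegral.continuous_parametric_intervalIntegral_of_continuous'
      exact (hrc.comp continuous_swap).mul (hac.comp continuous_snd)
    have hf := hr.mul_integral a ha
    have h1 := h _ hf (fun t _ => by simp [ha0, ha1])
    have h2 := setIntegral_Ksq (f := fun x => r x * starRingEnd ℂ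
      (((a.eval x.1 : ℝ) : ℂ) * M x.2))
      (hrc.mul (Complex.continuous_conj.comp hf.continuous))
    have h3 : ∀ y : ℝ, ∫ x in (0 : ℝ)..1, r (x, y) * starRingEnd ℂ (((a.eval x : ℝ) : ℂ) * M y)
        = ((‖M y‖ ^ 2 : ℝ) : ℂ) := by
      intro y
      have e1 : ∀ x : ℝ, r (x, y) * starRingEnd ℂ (((a.eval x : ℝ) : ℂ) * M y)
          = (r (x, y) * ((a.eval x : ℝ) : ℂ)) * starRingEnd ℂ (M y) := by
        intro x
        rw [map_mul, Complex.conj_ofReal]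
        ring
      simp_rw [e1]
      rw [intervalIntegral.integral_mul_const]
      change M y * starRingEnd ℂ (M y) = _
      rw [Complex.mul_conj, Complex.normSq_eq_norm_sq]
    replace h1 := h2.symm.trans h1
    simp_rw [h3] at h1
    rw [intervalIntegral.integral_ofReal, Complex.ofReal_eq_zero] at h1
    intro y hy
    by_contra hne
    have hpos := intervalIntegral.integral_pos (f := fun y => ‖M y‖ ^ 2) zero_lt_one
      (hMc.norm.pow 2).continuousOn (fun x _ => by positivity)
      ⟨y, hy, by have : 0 < ‖M y‖ := norm_pos_iff.2 hne
                 positivity⟩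
    exact hpos.ne' h1
  have hslice : ∀ y ∈ Set.Icc (0 : ℝ) 1, ∫ x in (0 : ℝ)..1, ‖r (x, y)‖ ^ 2
      ≤ 8 * p * ∫ x in (0 : ℝ)..1, ‖e (x, y)‖ ^ 2 := by
    intro y hy
    obtain ⟨P, Q, hP, hQ, hPQ⟩ := he.exists_slice y
    obtain ⟨A, B, hA, hB, hAB⟩ := hl.exists_slice y
    have hpd : ∀ x : ℝ, pd1 l (x, y) = (((Polynomial.derivative A).eval x : ℝ) : ℂ)
        + (((Polynomial.derivative B).eval x : ℝ) : ℂ) * Complex.I := by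
      intro x
      have h1 := hasDerivAt_pd1 (hl.differentiable (x, y))
      simp_rw [hAB] at h1
      exact h1.unique ((A.hasDerivAt x).ofReal_comp.add
        ((B.hasDerivAt x).ofReal_comp.mul_const Complex.I))
    have hrs : ∀ x : ℝ, r (x, y) = (((P + Polynomial.derivative A).eval x : ℝ) : ℂ)
        + (((Q + Polynomial.derivative B).eval x : ℝ) : ℂ) * Complex.I := by
      intro x
      rw [hrdef]
      dsimp only
      rw [hpd, hPQ]
      simp only [Polynomial.eval_add, Complex.ofReal_add]
      ring
    have horth : ∀ a : Polynomial ℝ, a.natDegree ≤ p → a.eval 0 = 0 → a.eval 1 = 0 →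
        unitInt ((P + Polynomial.derivative A) * a) = 0 ∧
        unitInt ((Q + Polynomial.derivative B) * a) = 0 := by
      intro a ha ha0 ha1
      have h1 := hmom a ha ha0 ha1 y hy
      simp_rw [hrs] at h1
      rw [integral_mul_eq_unitInt] at h1
      have hre := congrArg Complex.re h1
      have him := congrArg Complex.im h1
      simp at hre him
      exact ⟨hre, him⟩
    have i1 := unitInt_projection_error p hp P A hP hA fun a ha h0 h1 => (horth a ha h0 h1).1
    have i2 := unitInt_projection_error p hp Q B hQ hB fun a ha h0 h1 => (horth a ha h0 h1).2
    simp_rw [hrs, hPQ]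
    rw [integral_norm_sq_eq_unitInt, integral_norm_sq_eq_unitInt]
    linarith
  have hcr : Continuous fun x => ‖r x‖ ^ 2 := hrc.norm.pow 2
  have hce : Continuous fun x => ‖e x‖ ^ 2 := he.continuous.norm.pow 2
  have hpar : ∀ f : ℝ × ℝ → ℝ, Continuous f →
      Continuous fun y => ∫ x in (0 : ℝ)..1, f (x, y) := by
    intro f hf
    apply intervalIntegral.continuous_parametric_intervalIntegral_of_continuous'
    exact hf.comp continuous_swap
  rw [setIntegral_Ksq hcr, setIntegral_Ksq hce, ← intervalIntegral.integral_const_mul]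
  exact intervalIntegral.integral_mono_on zero_le_one ((hpar _ hcr).intervalIntegrable _ _)
    ((continuous_const.mul (hpar _ hce)).intervalIntegrable _ _) hslice

end ProjectionError

section Hilbert

variable {p : ℕ}

/-- A field continuous up to the boundary as an element of `L²(K)²`. -/
def fieldToLp (v : ℝ × ℝ → ℂ × ℂ) (hv : ContinuousOn v (closure Ksq)) :
    Lp (WithLp 2 (ℂ × ℂ)) 2 (volume.restrict Ksq) :=
  (memLp_Ksq (f := fun x => WithLp.toLp 2 (v x))
    ((WithLp.prod_continuous_toLp 2 ℂ ℂ).comp_continuousOn hv) 2).toLp _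

theorem coeFn_fieldToLp {v : ℝ × ℝ → ℂ × ℂ} (hv : ContinuousOn v (closure Ksq)) :
    fieldToLp v hv =ᵐ[volume.restrict Ksq] fun x => WithLp.toLp 2 (v x) :=
  MemLp.coeFn_toLp _

theorem inner_fieldToLp {u v : ℝ × ℝ → ℂ × ℂ} (hu : ContinuousOn u (closure Ksq))
    (hv : ContinuousOn v (closure Ksq)) :
    inner ℂ (fieldToLp v hv) (fieldToLp u hu) = ip2 u v := by
  rw [L2.inner_def, ip2]
  refine integral_congr_ae ?_
  filter_upwards [coeFn_fieldToLp hu, coeFn_fieldToLp hv] with x h1 h2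
  rw [h1, h2, WithLp.prod_inner_apply]
  simp [RCLike.inner_apply]

theorem norm_fieldToLp {u : ℝ × ℝ → ℂ × ℂ} (hu : ContinuousOn u (closure Ksq)) :
    ‖fieldToLp u hu‖ = nrm2 u := by
  have h := inner_self_eq_norm_sq_to_K (𝕜 := ℂ) (fieldToLp u hu)
  rw [inner_fieldToLp] at h
  have e : ip2 u u = ((∫ x in Ksq, (‖(u x).1‖ ^ 2 + ‖(u x).2‖ ^ 2) : ℝ) : ℂ) := by
    rw [ip2]
    refine Eq.trans ?_ integral_complex_ofReal
    congr 1
    funext x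
    simp [Complex.mul_conj, Complex.normSq_eq_norm_sq]
  rw [e] at h
  have h' : ∫ x in Ksq, (‖(u x).1‖ ^ 2 + ‖(u x).2‖ ^ 2) = ‖fieldToLp u hu‖ ^ 2 :=
    Complex.ofReal_injective (h.trans (Complex.ofReal_pow _ _).symm)
  rw [nrm2, h', Real.sqrt_sq (norm_nonneg _)]

theorem inner_toLp {f g : ℝ × ℝ → ℂ} (hf : MemLp f 2 (volume.restrict Ksq))
    (hg : MemLp g 2 (volume.restrict Ksq)) :
    inner ℂ (hg.toLp g) (hf.toLp f) = ip0 f g := by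
  rw [L2.inner_def, ip0]
  refine integral_congr_ae ?_
  filter_upwards [hf.coeFn_toLp, hg.coeFn_toLp] with x h1 h2
  rw [h1, h2, RCLike.inner_apply]

theorem IsPoly2.eq_zero_of_eqOn {p₁ p₂ : ℕ} {f : ℝ × ℝ → ℂ} (hf : IsPoly2 p₁ p₂ f)
    (h : ∀ x ∈ Ksq, f x = 0) (x : ℝ × ℝ) : f x = 0 := by
  have key : ∀ {q₁ q₂ : ℕ} {g : ℝ × ℝ → ℂ}, IsPoly2 q₁ q₂ g → ∀ y : ℝ,
      (∀ s ∈ Set.Ioo (0 : ℝ) 1, g (s, y) = 0) → ∀ s, g (s, y) = 0 := by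
    intro q₁ q₂ g hg y hy s
    obtain ⟨P, Q, -, -, hPQ⟩ := hg.exists_slice y
    have hz : ∀ A : Polynomial ℝ, (∀ s ∈ Set.Ioo (0 : ℝ) 1, A.eval s = 0) → A = 0 := fun A hA =>
      Polynomial.eq_zero_of_infinite_isRoot A ((Set.Ioo_infinite zero_lt_one).mono hA)
    have hP : P = 0 := hz P fun t ht => by
      have := congrArg Complex.re ((hPQ t).symm.trans (hy t ht))
      simpa using this
    have hQ : Q = 0 := hz Q fun t ht => by
      have := congrArg Complex.im ((hPQ t).symm.trans (hy t ht))
      simpa using this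
    rw [hPQ, hP, hQ]
    simp
  have h1 : ∀ y ∈ Set.Ioo (0 : ℝ) 1, ∀ s, f (s, y) = 0 := fun y hy =>
    key hf y fun s hs => h _ ⟨hs, hy⟩
  exact key hf.comp_swap x.1 (fun s hs => h1 s hs x.1) x.2

theorem eqOn_Ksq_of_ae_eq {E : Type*} [TopologicalSpace E] [T2Space E] {f g : ℝ × ℝ → E}
    (hf : ContinuousOn f (closure Ksq)) (hg : ContinuousOn g (closure Ksq))
    (h : f =ᵐ[volume.restrict Ksq] g) : Set.EqOn f g Ksq :=
  Measure.eqOn_open_of_ae_eq h isOpen_Ksq (hf.mono subset_closure) (hg.mono subset_closure)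

theorem MemRT0.isPoly2_vdiv {v : ℝ × ℝ → ℂ × ℂ} (hv : MemRT0 p v) :
    IsPoly2 (p - 1) (p - 1) (vdiv v) :=
  hv.1.1.pd1.add hv.1.2.pd2

theorem MemRT0.continuousOn {v : ℝ × ℝ → ℂ × ℂ} (hv : MemRT0 p v) :
    ContinuousOn v (closure Ksq) :=
  (hv.1.1.continuous.prodMk hv.1.2.continuous).continuousOn

/-- The space `RT_p⁰(K)`. -/
def rt0 (p : ℕ) : Submodule ℂ (ℝ × ℝ → ℂ × ℂ) where
  carrier := {v | MemRT0 p v}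
  add_mem' {v w} hv hw := by
    refine ⟨⟨hv.1.1.add hw.1.1, hv.1.2.add hw.1.2⟩, fun t ht => ?_⟩
    obtain ⟨a1, a2, a3, a4⟩ := hv.2 t ht
    obtain ⟨b1, b2, b3, b4⟩ := hw.2 t ht
    simp [a1, a2, a3, a4, b1, b2, b3, b4]
  zero_mem' := ⟨⟨isPoly2_zero, isPoly2_zero⟩, fun t _ => by simp⟩
  smul_mem' c v hv := by
    refine ⟨⟨hv.1.1.const_mul c, hv.1.2.const_mul c⟩, fun t ht => ?_⟩
    obtain ⟨a1, a2, a3, a4⟩ := hv.2 t ht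
    simp [a1, a2, a3, a4]

instance finiteDimensional_rt0 (p : ℕ) : FiniteDimensional ℂ (rt0 p) := by
  let L : ((Fin (p + 1) → Fin (p - 1 + 1) → ℂ) × (Fin (p - 1 + 1) → Fin (p + 1) → ℂ)) →ₗ[ℂ]
      (ℝ × ℝ → ℂ × ℂ) :=
    { toFun := fun c x => (poly2OfCoeff p (p - 1) c.1 x, poly2OfCoeff (p - 1) p c.2 x)
      map_add' := fun c d => by
        funext x
        simp
      map_smul' := fun a c => by
        funext x
        simp }
  have h : rt0 p ≤ LinearMap.range L := by
    rintro v ⟨⟨⟨c, hc⟩, ⟨d, hd⟩⟩, -⟩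
    exact ⟨(c, d), funext fun x => Prod.ext (hc x).symm (hd x).symm⟩
  exact Submodule.finiteDimensional_of_le h

/-- The embedding of `RT_p⁰(K)` into `L²(K)²`. -/
def rt0ToLp (p : ℕ) : rt0 p →ₗ[ℂ] Lp (WithLp 2 (ℂ × ℂ)) 2 (volume.restrict Ksq) where
  toFun v := fieldToLp v.1 v.2.continuousOn
  map_add' _ _ := rfl
  map_smul' _ _ := rfl

theorem vdiv_add {v w : ℝ × ℝ → ℂ × ℂ} (hv : MemRT0 p v) (hw : MemRT0 p w) :
    vdiv (v + w) = vdiv v + vdiv w := by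
  funext x
  have e1 := pd1_add (hv.1.1.differentiable x) (hw.1.1.differentiable x)
  have e2 := pd2_add (hv.1.2.differentiable x) (hw.1.2.differentiable x)
  simp only [vdiv, Pi.add_apply, Prod.fst_add, Prod.snd_add, e1, e2]
  ring

theorem vdiv_smul (c : ℂ) {v : ℝ × ℝ → ℂ × ℂ} (hv : MemRT0 p v) :
    vdiv (c • v) = c • vdiv v := by
  funext x
  have e1 := pd1_const_mul (hv.1.1.differentiable x) c
  have e2 := pd2_const_mul (hv.1.2.differentiable x) c
  simp only [vdiv, Pi.smul_apply, Prod.smul_fst, Prod.smul_snd, smul_eq_mul, e1, e2]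
  ring

theorem MemRT0.memLp_vdiv {v : ℝ × ℝ → ℂ × ℂ} (hv : MemRT0 p v) :
    MemLp (vdiv v) 2 (volume.restrict Ksq) :=
  memLp_Ksq hv.isPoly2_vdiv.continuous.continuousOn 2

/-- The divergence `RT_p⁰(K) → L²(K)`. -/
def rt0Div (p : ℕ) : rt0 p →ₗ[ℂ] Lp ℂ 2 (volume.restrict Ksq) where
  toFun v := v.2.memLp_vdiv.toLp (vdiv v.1)
  map_add' v w := by
    rw [← MemLp.toLp_add]
    congr 1
    exact vdiv_add v.2 w.2
  map_smul' c v := by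
    rw [RingHom.id_apply, ← MemLp.toLp_const_smul]
    congr 1
    exact vdiv_smul c v.2

theorem rt0ToLp_injective (p : ℕ) : Function.Injective (rt0ToLp p) := by
  rw [injective_iff_map_eq_zero]
  intro v hv
  have h0 := (coeFn_fieldToLp v.2.continuousOn).symm.trans
    (((Lp.eq_zero_iff_ae_eq_zero).1 hv))
  have h : v.1 =ᵐ[volume.restrict Ksq] 0 := by
    filter_upwards [h0] with x hx
    simpa using hx
  have h1 := eqOn_Ksq_of_ae_eq v.2.continuousOn continuousOn_const h
  refine Subtype.ext (funext fun x => Prod.ext ?_ ?_)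
  · exact v.2.1.1.eq_zero_of_eqOn (fun y hy => congrArg Prod.fst (h1 hy)) x
  · exact v.2.1.2.eq_zero_of_eqOn (fun y hy => congrArg Prod.snd (h1 hy)) x

theorem rt0Div_eq_zero_iff (v : rt0 p) : rt0Div p v = 0 ↔ ∀ x, vdiv v.1 x = 0 := by
  constructor
  · intro h
    have h1 := eqOn_Ksq_of_ae_eq v.2.isPoly2_vdiv.continuous.continuousOn
      (continuousOn_const (c := (0 : ℂ)))
      ((v.2.memLp_vdiv.coeFn_toLp).symm.trans ((Lp.eq_zero_iff_ae_eq_zero).1 h))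
    exact v.2.isPoly2_vdiv.eq_zero_of_eqOn h1
  · intro h
    refine (Lp.eq_zero_iff_ae_eq_zero).2 ((v.2.memLp_vdiv.coeFn_toLp).trans ?_)
    exact Filter.Eventually.of_forall h

end Hilbert

section Exactness

variable {p : ℕ} {φ : ℝ × ℝ → ℂ}

theorem HasDerivAt.eq_zero_of_eqOn_Icc {g : ℝ → ℂ} {d : ℂ} {t : ℝ} (hg : HasDerivAt g d t)
    (ht : t ∈ Set.Icc (0 : ℝ) 1) (h0 : ∀ s ∈ Set.Icc (0 : ℝ) 1, g s = 0) : d = 0 :=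
  (uniqueDiffOn_Icc zero_lt_one t ht).eq_deriv _ hg.hasDerivWithinAt
    ((hasDerivWithinAt_const t _ (0 : ℂ)).congr h0 (h0 t ht))

theorem eq_zero_of_hasDerivAt_zero_Icc {g g' : ℝ → ℂ} (hg : ∀ t, HasDerivAt g (g' t) t)
    (hg' : ∀ t ∈ Set.Icc (0 : ℝ) 1, g' t = 0) (h0 : g 0 = 0) :
    ∀ t ∈ Set.Icc (0 : ℝ) 1, g t = 0 := by
  intro t ht
  rw [← h0]
  exact constant_of_has_deriv_right_zero (fun s _ => (hg s).continuousAt.continuousWithinAt)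
    (fun s hs => by
      rw [← hg' s (Set.Ico_subset_Icc_self hs)]
      exact (hg s).hasDerivWithinAt) t ht

theorem MemP0.memRT0_scurl (hφ : MemP0 p φ) : MemRT0 p (scurl φ) := by
  have hd := hφ.1.differentiable
  refine ⟨⟨hφ.1.pd2, hφ.1.pd1.neg⟩, fun t ht => ⟨?_, ?_, ?_, ?_⟩⟩
  · exact (hasDerivAt_pd2 (hd (0, t))).eq_zero_of_eqOn_Icc ht fun s hs => (hφ.2 s hs).2.2.1
  · exact (hasDerivAt_pd2 (hd (1, t))).eq_zero_of_eqOn_Icc ht fun s hs => (hφ.2 s hs).2.2.2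
  · exact neg_eq_zero.2 <|
      (hasDerivAt_pd1 (hd (t, 0))).eq_zero_of_eqOn_Icc ht fun s hs => (hφ.2 s hs).1
  · exact neg_eq_zero.2 <|
      (hasDerivAt_pd1 (hd (t, 1))).eq_zero_of_eqOn_Icc ht fun s hs => (hφ.2 s hs).2.1

theorem vdiv_scurl (hφ : ContDiff ℝ 2 φ) (x : ℝ × ℝ) : vdiv (scurl φ) x = 0 := by
  simp only [vdiv, scurl]
  rw [pd2_neg, ← pd1_pd2_comm hφ, add_neg_cancel]

/-- Exactness of the discrete complex: divergence-free fields in `RT_p⁰(K)` are curls. -/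
theorem MemRT0.exists_scurl_eq (hp : 1 ≤ p) {w : ℝ × ℝ → ℂ × ℂ} (hw : MemRT0 p w)
    (hdiv : ∀ x, vdiv w x = 0) : ∃ φ, MemP0 p φ ∧ scurl φ = w := by
  obtain ⟨φ, hφ, hφ2, hφ0⟩ := hw.1.1.exists_pd2_eq
  rw [Nat.sub_add_cancel hp] at hφ
  have hd := hφ.differentiable
  have hψ : IsPoly2 p p (fun x => pd1 φ x + (w x).2) :=
    (hφ.pd1.of_le (Nat.sub_le _ _) le_rfl).add (hw.1.2.of_le (Nat.sub_le _ _) le_rfl)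
  have hψ2 : ∀ x, pd2 (fun x => pd1 φ x + (w x).2) x = 0 := by
    intro x
    rw [pd2_add (hφ.pd1.differentiable x) (hw.1.2.differentiable x),
      ← pd1_pd2_comm hφ.contDiff, hφ2]
    exact hdiv x
  have hψ0 : ∀ x, pd1 φ x + (w x).2 = 0 := by
    refine hψ.eq_zero_of_eqOn ?_
    rintro ⟨x, y⟩ ⟨hx, -⟩
    have hc : ∀ s : ℝ, HasDerivAt (fun s => pd1 φ (x, s) + (w (x, s)).2) 0 s := by
      intro s
      have h := hasDerivAt_pd2 (hψ.differentiable (x, s))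
      rwa [hψ2] at h
    have h1 := is_const_of_deriv_eq_zero (fun s => (hc s).differentiableAt)
      (fun s => (hc s).deriv) y 0
    have h2 : pd1 φ (x, 0) = 0 := by
      have h := hasDerivAt_pd1 (hd (x, 0))
      simp_rw [hφ0] at h
      exact h.unique (hasDerivAt_const x 0)
    rw [h1, h2, (hw.2 x (Set.Ioo_subset_Icc_self hx)).2.2.1, zero_add]
  have e1 : ∀ x, pd1 φ x = -(w x).2 := fun x => eq_neg_of_add_eq_zero_left (hψ0 x)
  have b3 := eq_zero_of_hasDerivAt_zero_Icc (fun t => hasDerivAt_pd2 (hd (0, t)))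
    (fun t ht => by rw [hφ2]; exact (hw.2 t ht).1) (hφ0 0)
  have b4 := eq_zero_of_hasDerivAt_zero_Icc (fun t => hasDerivAt_pd2 (hd (1, t)))
    (fun t ht => by rw [hφ2]; exact (hw.2 t ht).2.1) (hφ0 1)
  have b2 := eq_zero_of_hasDerivAt_zero_Icc (fun t => hasDerivAt_pd1 (hd (t, 1)))
    (fun t ht => by rw [e1, (hw.2 t ht).2.2.2, neg_zero])
    (b3 1 (Set.right_mem_Icc.2 zero_le_one))
  refine ⟨φ, ⟨hφ, fun t ht => ⟨hφ0 t, b2 t ht, b3 t ht, b4 t ht⟩⟩, funext fun x => ?_⟩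
  rw [scurl, hφ2, e1, neg_neg]

end Exactness

section Stability

variable {p : ℕ} {u : ℝ × ℝ → ℂ × ℂ}

/-- If `e + ∇l` is orthogonal to `RT_p⁰(K)`, then it is controlled by `e`. -/
theorem nrm2_add_sgrad_le (hp : 1 ≤ p) {e : ℝ × ℝ → ℂ × ℂ} (he : MemRT0 p e) {l : ℝ × ℝ → ℂ}
    (hl : IsPoly2 (p - 1) (p - 1) l)
    (h : ∀ w, MemRT0 p w → ip2 (fun x => e x + sgrad l x) w = 0) :
    nrm2 (fun x => e x + sgrad l x) ≤ Real.sqrt (8 * p) * nrm2 e := by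
  have h1 := setIntegral_projection_error hp he.1.1 hl fun f hf hb => by
    have := h (fun x => (f x, 0)) ⟨⟨hf, isPoly2_zero⟩, fun t ht => by
      simp [(hb t ht).1, (hb t ht).2]⟩
    simpa [ip2, sgrad] using this
  have hsw : ∀ x : ℝ × ℝ, pd1 (fun y => l y.swap) x = pd2 l x.swap := fun x =>
    pd1_comp_swap (hl.differentiable _)
  have h2 := setIntegral_projection_error hp he.1.2.comp_swap hl.comp_swap fun f hf hb => by
    have := h (fun x => (0, f x.swap)) ⟨⟨isPoly2_zero, hf.comp_swap⟩, fun t ht => by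
      simp [(hb t ht).1, (hb t ht).2]⟩
    rw [← setIntegral_Ksq_swap]
    simpa [ip2, sgrad, hsw] using this
  simp_rw [hsw] at h2
  rw [setIntegral_Ksq_swap fun x => ‖(e x).2 + pd2 l x‖ ^ 2,
    setIntegral_Ksq_swap fun x => ‖(e x).2‖ ^ 2] at h2
  have hi : ∀ {f : ℝ × ℝ → ℂ}, Continuous f → IntegrableOn (fun x => ‖f x‖ ^ 2) Ksq :=
    fun hf => integrableOn_Ksq (hf.norm.pow 2).continuousOn
  have c1 := he.1.1.continuous
  have c2 := he.1.2.continuous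
  rw [nrm2, nrm2, ← Real.sqrt_mul (by positivity)]
  refine Real.sqrt_le_sqrt ?_
  rw [integral_add (hi c1) (hi c2)]
  refine (integral_add (hi (c1.add hl.pd1.continuous)) (hi (c2.add hl.pd2.continuous))).trans_le ?_
  rw [mul_add]
  exact add_le_add h1 h2

theorem IsC1Ksq.continuousOn_vdiv (hu : IsC1Ksq u) : ContinuousOn (vdiv u) (closure Ksq) :=
  hu.fst.continuousOn_pd1.add hu.snd.continuousOn_pd2

theorem IsC1Ksq.continuousOn_field (hu : IsC1Ksq u) : ContinuousOn u (closure Ksq) :=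
  hu.fst.continuousOn.prodMk hu.snd.continuousOn

theorem inner_rt0ToLp_sub (hu : ContinuousOn u (closure Ksq)) (r w : rt0 p) :
    inner ℂ (rt0ToLp p w) (fieldToLp u hu - rt0ToLp p r) = ip2 (fun x => u x - r.1 x) w.1 :=
  inner_fieldToLp (hu.sub r.2.continuousOn) w.2.continuousOn

theorem norm_sub_rt0ToLp (hu : ContinuousOn u (closure Ksq)) (r : rt0 p) :
    ‖fieldToLp u hu - rt0ToLp p r‖ = nrm2 (fun x => u x - r.1 x) :=
  norm_fieldToLp (hu.sub r.2.continuousOn)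

theorem inner_rt0Div_sub (hu : MemLp (vdiv u) 2 (volume.restrict Ksq)) (r v : rt0 p) :
    inner ℂ (rt0Div p v) (hu.toLp (vdiv u) - rt0Div p r)
      = ip0 (fun x => vdiv u x - vdiv r.1 x) (vdiv v.1) :=
  inner_toLp (hu.sub r.2.memLp_vdiv) v.2.memLp_vdiv

theorem norm_inner_rt0Div_sub_le (hp : 1 ≤ p) (hu : IsC1Ksq u)
    (hb : ∀ t ∈ Set.Icc (0 : ℝ) 1,
      (u (0, t)).1 = 0 ∧ (u (1, t)).1 = 0 ∧ (u (t, 0)).2 = 0 ∧ (u (t, 1)).2 = 0)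
    (q m e : rt0 p)
    (hq : ∀ w, inner ℂ (rt0ToLp p w) (fieldToLp u hu.continuousOn_field - rt0ToLp p q) = 0)
    (he : ∀ w, inner ℂ (rt0ToLp p e) (rt0ToLp p w) = inner ℂ (rt0Div p m) (rt0Div p w)) :
    ‖inner ℂ (rt0Div p m) ((memLp_Ksq hu.continuousOn_vdiv 2).toLp (vdiv u) - rt0Div p q)‖
      ≤ Real.sqrt (8 * p) * ‖rt0ToLp p e‖ * ‖fieldToLp u hu.continuousOn_field - rt0ToLp p q‖ := by
  set l := vdiv m.1 with hldef
  have hl : IsPoly2 (p - 1) (p - 1) l := m.2.isPoly2_vdiv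
  have hlc : ContinuousOn (sgrad l) (closure Ksq) :=
    hl.isC1Ksq.continuousOn_pd1.prodMk hl.isC1Ksq.continuousOn_pd2
  have hparts : inner ℂ (rt0Div p m)
      ((memLp_Ksq hu.continuousOn_vdiv 2).toLp (vdiv u) - rt0Div p q)
      = -inner ℂ (rt0ToLp p e + fieldToLp (sgrad l) hlc)
        (fieldToLp u hu.continuousOn_field - rt0ToLp p q) := by
    rw [inner_add_left, hq, zero_add, inner_rt0Div_sub]
    refine Eq.trans ?_ (congrArg Neg.neg
      (inner_fieldToLp (hu.continuousOn_field.sub q.2.continuousOn) hlc)).symm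
    refine Eq.trans ?_ (ip0_vdiv_eq_neg_ip2_sgrad (w := fun x => u x - q.1 x)
      (hu.fst.sub q.2.1.1.isC1Ksq) (hu.snd.sub q.2.1.2.isC1Ksq) hl.isC1Ksq fun t ht => ?_)
    · refine setIntegral_congr_fun isOpen_Ksq.measurableSet fun x hx => ?_
      have hx' := subset_closure hx
      have e1 := pd1_sub (hu.fst.differentiableAt hx') (q.2.1.1.differentiable x)
      have e2 := pd2_sub (hu.snd.differentiableAt hx') (q.2.1.2.differentiable x)
      simp only [vdiv, Prod.fst_sub, Prod.snd_sub, e1, e2, hldef]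
      ring
    · obtain ⟨a1, a2, a3, a4⟩ := hb t ht
      obtain ⟨b1, b2, b3, b4⟩ := q.2.2 t ht
      simp [a1, a2, a3, a4, b1, b2, b3, b4]
  have hnorm : ‖rt0ToLp p e + fieldToLp (sgrad l) hlc‖ ≤ Real.sqrt (8 * p) * ‖rt0ToLp p e‖ := by
    have hec : ContinuousOn (fun x => e.1 x + sgrad l x) (closure Ksq) :=
      e.2.continuousOn.add hlc
    have h := nrm2_add_sgrad_le hp e.2 hl fun w hw => by
      rw [← inner_fieldToLp hec hw.continuousOn, inner_eq_zero_symm]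
      change inner ℂ (rt0ToLp p e + fieldToLp (sgrad l) hlc) (rt0ToLp p ⟨w, hw⟩) = 0
      rw [inner_add_left, he]
      refine (congrArg₂ _ (inner_toLp hw.memLp_vdiv m.2.memLp_vdiv)
        (inner_fieldToLp hw.continuousOn hlc)).trans ?_
      rw [ip0_vdiv_eq_neg_ip2_sgrad hw.1.1.isC1Ksq hw.1.2.isC1Ksq hl.isC1Ksq hw.2]
      exact neg_add_cancel _
    rw [← norm_fieldToLp (MemRT0.continuousOn e.2), ← norm_fieldToLp hec] at h
    exact h
  rw [hparts, norm_neg]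
  exact (norm_inner_le_norm _ _).trans (mul_le_mul_of_nonneg_right hnorm (norm_nonneg _))

theorem forall_ip2_scurl_eq_zero_iff (hp : 1 ≤ p) (hu : ContinuousOn u (closure Ksq))
    (r : rt0 p) :
    (∀ φ, MemP0 p φ → ip2 (fun x => u x - r.1 x) (scurl φ) = 0) ↔
      ∀ w, rt0Div p w = 0 → inner ℂ (rt0ToLp p w) (fieldToLp u hu - rt0ToLp p r) = 0 := by
  constructor
  · intro h w hw
    obtain ⟨φ, hφ, hφw⟩ := w.2.exists_scurl_eq hp ((rt0Div_eq_zero_iff w).1 hw)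
    rw [inner_rt0ToLp_sub, ← hφw]
    exact h φ hφ
  · intro h φ hφ
    have := h ⟨scurl φ, hφ.memRT0_scurl⟩
      ((rt0Div_eq_zero_iff _).2 fun x => vdiv_scurl hφ.1.contDiff x)
    rwa [inner_rt0ToLp_sub] at this

theorem forall_ip0_vdiv_eq_zero_iff (hu : MemLp (vdiv u) 2 (volume.restrict Ksq)) (r : rt0 p) :
    (∀ v, MemRT0 p v → ip0 (fun x => vdiv u x - vdiv r.1 x) (vdiv v) = 0) ↔
      ∀ v, inner ℂ (rt0Div p v) (hu.toLp (vdiv u) - rt0Div p r) = 0 := by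
  simp_rw [inner_rt0Div_sub]
  exact ⟨fun h v => h v.1 v.2, fun h v hv => h ⟨v, hv⟩⟩

end Stability

/-- Quasi-stability of the projection-based interior interpolant for curl-free C¹ bubble
fields: the interpolant `u_p ∈ RT_p⁰(K)` defined by the two projection systems exists and
is unique, is discrete curl-free, and satisfies
`‖u − u_p‖_{0,K} ≤ C p^{1/2} inf_{q ∈ RT_p⁰(K)} ‖u − q‖_{0,K}`
with `C` independent of `p` and `u`. -/
theorem projection_interpolant_quasi_stability :
    ∃ C > 0, ∀ p : ℕ, 1 ≤ p → ∀ u : ℝ × ℝ → ℂ × ℂ,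
      (∃ U, IsOpen U ∧ closure Ksq ⊆ U ∧ ContDiffOn ℝ 1 u U) →
      (∀ x ∈ Ksq, pd1 (fun y => (u y).2) x - pd2 (fun y => (u y).1) x = 0) →
      (∀ t ∈ Set.Icc (0 : ℝ) 1,
        (u (0, t)).1 = 0 ∧ (u (1, t)).1 = 0 ∧ (u (t, 0)).2 = 0 ∧ (u (t, 1)).2 = 0) →
      (∃! up : ℝ × ℝ → ℂ × ℂ, MemRT0 p up ∧
        (∀ v, MemRT0 p v → ip0 (fun x => vdiv u x - vdiv up x) (vdiv v) = 0) ∧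
        (∀ φ, MemP0 p φ → ip2 (fun x => u x - up x) (scurl φ) = 0)) ∧
      ∀ up : ℝ × ℝ → ℂ × ℂ, MemRT0 p up →
        (∀ v, MemRT0 p v → ip0 (fun x => vdiv u x - vdiv up x) (vdiv v) = 0) →
        (∀ φ, MemP0 p φ → ip2 (fun x => u x - up x) (scurl φ) = 0) →
        (∀ φ, MemP0 p φ → ip2 up (scurl φ) = 0) ∧
        nrm2 (fun x => u x - up x) ≤
          C * Real.sqrt (p : ℝ) *
            sInf { r : ℝ | ∃ q, MemRT0 p q ∧ r = nrm2 (fun x => u x - q x) } := by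
  refine ⟨4, by norm_num, fun p hp u hu hcurl hb => ?_⟩
  replace hu : IsC1Ksq u := hu
  have huc := hu.continuousOn_field
  have hdc := memLp_Ksq hu.continuousOn_vdiv 2
  refine ⟨?_, ?_⟩
  · obtain ⟨r, ⟨h1, h2⟩, hr⟩ := existsUnique_constrained_projection (rt0ToLp p)
      (rt0ToLp_injective p) (rt0Div p) (fieldToLp u huc) (hdc.toLp (vdiv u))
    refine ⟨r.1, ⟨r.2, (forall_ip0_vdiv_eq_zero_iff hdc r).2 h1,
      (forall_ip2_scurl_eq_zero_iff hp huc r).2 h2⟩, ?_⟩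
    rintro s ⟨hs, hs1, hs2⟩
    exact congrArg Subtype.val (hr ⟨s, hs⟩ ⟨(forall_ip0_vdiv_eq_zero_iff hdc ⟨s, hs⟩).1 hs1,
      (forall_ip2_scurl_eq_zero_iff hp huc ⟨s, hs⟩).1 hs2⟩)
  · intro up hup hup1 hup2
    refine ⟨fun φ hφ => ?_, ?_⟩
    · have h0 := ip2_scurl_eq_zero hu.fst hu.snd hφ.1.isC1Ksq hcurl hφ.2
      have h := (inner_rt0ToLp_sub huc ⟨up, hup⟩ ⟨scurl φ, hφ.memRT0_scurl⟩).trans (hup2 φ hφ)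
      rw [inner_sub_right, ← (inner_fieldToLp huc hφ.memRT0_scurl.continuousOn).trans h0] at h
      have h' := sub_eq_self.1 h
      exact (inner_fieldToLp hup.continuousOn hφ.memRT0_scurl.continuousOn).symm.trans h'
    · have hp' : (1 : ℝ) ≤ Real.sqrt p := Real.one_le_sqrt.2 (by exact_mod_cast hp)
      have h8 : Real.sqrt (8 * p) ≤ 3 * Real.sqrt p := by
        rw [Real.sqrt_mul (by norm_num)]
        gcongr
        exact Real.sqrt_le_iff.2 ⟨by norm_num, by norm_num⟩
      have hmain : ∀ q, MemRT0 p q → nrm2 (fun x => u x - up x)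
          ≤ 4 * Real.sqrt p * nrm2 (fun x => u x - q x) := by
        intro q hq
        have h := norm_sub_constrained_projection_le (rt0ToLp p) (rt0Div p) (fieldToLp u huc)
          (hdc.toLp (vdiv u)) (Real.sqrt (8 * p)) (norm_inner_rt0Div_sub_le hp hu hb)
          (Real.sqrt_nonneg _) ⟨up, hup⟩ ((forall_ip0_vdiv_eq_zero_iff hdc ⟨up, hup⟩).1 hup1)
          ((forall_ip2_scurl_eq_zero_iff hp huc ⟨up, hup⟩).1 hup2) ⟨q, hq⟩
        rw [norm_sub_rt0ToLp, norm_sub_rt0ToLp] at h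
        exact h.trans (mul_le_mul_of_nonneg_right (by linarith) (Real.sqrt_nonneg _))
      rw [← div_le_iff₀' (by positivity)]
      refine le_csInf ⟨_, 0, (rt0 p).zero_mem, rfl⟩ ?_
      rintro _ ⟨q, hq, rfl⟩
      rw [div_le_iff₀' (by positivity)]
      exact hmain q hq
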